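/- arXiv:1203.4956 — 2 statements merged into one kernel-verified Lean document; each statement's English description precedes it below -/
import Mathlib

section
/- Let A be a unital n-subhomogeneous C*-algebra. Then there exist nets of finite-dimensional n-subhomogeneous C*-algebras F_α, unital *-homomorphisms φ_α : A → F_α, and u.c.p. maps ψ_α : F_α → A such that ‖x − ψ_α(φ_α(x))‖ → 0 for all x ∈ A. -/
noncomputable section

/-- An element of a `*`-ring is positive if it is of the form `star b * b`.
(In a C*-algebra this is the usual positivity.) -/
def IsPosElem {A : Type*} [NonUnitalSemiring A] [StarRing A] (a : A) : Prop :=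
  ∃ b, a = star b * b

/-- A linear map `φ : A → B` between `*`-algebras is `k`-positive if
`φ ⊗ id_{M_k} : M_k(A) → M_k(B)` (i.e. the entrywise application of `φ`)
maps positive elements to positive elements. -/
def KPositive {A B : Type*} [NonUnitalRing A] [StarRing A] [Module ℂ A]
    [NonUnitalRing B] [StarRing B] [Module ℂ B] (k : ℕ) (φ : A →ₗ[ℂ] B) : Prop :=
  ∀ x : Matrix (Fin k) (Fin k) A, IsPosElem x → IsPosElem (x.map φ)

/-- A linear map is completely positive if it is `k`-positive for all `k`. -/
def CompletelyPositive {A B : Type*} [NonUnitalRing A] [StarRing A] [Module ℂ A]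
    [NonUnitalRing B] [StarRing B] [Module ℂ B] (φ : A →ₗ[ℂ] B) : Prop :=
  ∀ k : ℕ, KPositive k φ
def IsIrreducibleRep {A : Type*} [NonUnitalNonAssocSemiring A] [DistribMulAction ℂ A] [Star A]
    {H : Type*} [NormedAddCommGroup H] [InnerProductSpace ℂ H] [CompleteSpace H]
    (π : A →⋆ₙₐ[ℂ] (H →L[ℂ] H)) : Prop :=
  (∃ a, π a ≠ 0) ∧
    ∀ S : Submodule ℂ H, IsClosed (S : Set H) →
      (∀ a : A, ∀ v ∈ S, π a v ∈ S) → S = ⊥ ∨ S = ⊤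

/-- A `*`-algebra is `n`-subhomogeneous if all its irreducible representations (on complex
Hilbert spaces) have dimension at most `n`. -/
def IsSubhomogeneous (n : ℕ) (A : Type*) [NonUnitalNonAssocSemiring A]
    [DistribMulAction ℂ A] [Star A] : Prop :=
  ∀ (H : Type) [NormedAddCommGroup H] [InnerProductSpace ℂ H] [CompleteSpace H]
    (π : A →⋆ₙₐ[ℂ] (H →L[ℂ] H)), IsIrreducibleRep π → Module.rank ℂ H ≤ n

open Filter Topology

/-- A net (indexed by a nonempty directed preorder) of finite-dimensional
`n`-subhomogeneous C*-algebras `F i`, unital `*`-homomorphisms `φ i : A → F i` and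
u.c.p. maps `ψ i : F i → A`, such that `‖x - ψ i (φ i x)‖ → 0` for every `x ∈ A`. -/
structure SubhomApproxNet (n : ℕ) (A : Type) [CStarAlgebra A] where
  ι : Type
  [pre : Preorder ι]
  [ne : Nonempty ι]
  directed : ∀ a b : ι, ∃ c, a ≤ c ∧ b ≤ c
  F : ι → Type
  [instF : ∀ i, CStarAlgebra (F i)]
  findim : ∀ i, FiniteDimensional ℂ (F i)
  subhom : ∀ i, IsSubhomogeneous n (F i)
  φ : ∀ i, A →⋆ₐ[ℂ] F i
  ψ : ∀ i, F i →ₗ[ℂ] A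
  ψ_unital : ∀ i, ψ i 1 = 1
  ψ_cp : ∀ i, CompletelyPositive (ψ i)
  approx : ∀ x : A, Filter.Tendsto (fun i => ‖x - ψ i (φ i x)‖) Filter.atTop (𝓝 0)

section

open scoped ComplexOrder InnerProductSpace

/-- The GNS representation of a positive functional, together with its cyclic vector. -/
theorem exists_gns {A : Type} [CStarAlgebra A] (g : A →ₗ[ℂ] ℂ) (hg : ∀ a, 0 ≤ g (star a * a)) :
    ∃ (H : Type) (_ : NormedAddCommGroup H) (_ : InnerProductSpace ℂ H) (_ : CompleteSpace H)
      (π : A →⋆ₐ[ℂ] (H →L[ℂ] H)) (ξ : H),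
      (∀ a, g a = ⟪ξ, π a ξ⟫_ℂ) ∧ DenseRange (fun a => π a ξ) := by
  let := CStarAlgebra.spectralOrder A
  have := CStarAlgebra.spectralOrderedRing A
  let f : A →ₚ[ℂ] ℂ := PositiveLinearMap.mk₀ g fun a ha => by
    obtain ⟨b, rfl⟩ := CStarAlgebra.nonneg_iff_eq_star_mul_self.1 ha
    exact hg b
  have key : ∀ a, f.gnsStarAlgHom a ((f.toPreGNS 1 : f.PreGNS) : f.GNS) =
      (f.toPreGNS a : f.GNS) := by
    intro a
    change f.gnsNonUnitalStarAlgHom a _ = _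
    rw [PositiveLinearMap.gnsNonUnitalStarAlgHom_apply_coe]
    simp
  refine ⟨f.GNS, inferInstance, inferInstance, inferInstance, f.gnsStarAlgHom,
    ((f.toPreGNS 1 : f.PreGNS) : f.GNS), fun a => ?_, ?_⟩
  · rw [key, UniformSpace.Completion.inner_coe, PositiveLinearMap.preGNS_inner_def]
    simp only [PositiveLinearMap.ofPreGNS_toPreGNS, star_one, one_mul]
    rfl
  · simp only [key]
    exact (UniformSpace.Completion.denseRange_coe).comp f.toPreGNS.surjective.denseRange
      (UniformSpace.Completion.continuous_coe _)

/-- Separation of a self-adjoint element from a convex cone of self-adjoint elements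
containing the positive ones, by a positive functional. -/
theorem exists_positive_separating {B : Type} [CStarAlgebra B] (W : Set B)
    (hsa : ∀ w ∈ W, IsSelfAdjoint w) (hadd : ∀ v ∈ W, ∀ w ∈ W, v + w ∈ W)
    (hsmul : ∀ r : ℝ, 0 ≤ r → ∀ w ∈ W, r • w ∈ W) (hpos : ∀ b : B, star b * b ∈ W)
    (x : B) (hx : IsSelfAdjoint x) (hxW : x ∉ closure W) :
    ∃ g : B →ₗ[ℂ] ℂ, (∀ a, 0 ≤ g (star a * a)) ∧ (∀ w ∈ W, 0 ≤ (g w).re) ∧ (g x).re < 0 := by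
  have h0 : (0 : B) ∈ W := by simpa using hpos 0
  let C : ProperCone ℝ B :=
    { carrier := closure W
      add_mem' := fun {a b} ha hb => map_mem_closure₂ continuous_add ha hb
        (fun v hv w hw => hadd v hv w hw)
      zero_mem' := subset_closure h0
      smul_mem' := fun r a ha => by
        refine map_mem_closure (f := fun b : B => (r : ℝ) • b) (continuous_const_smul _) ha ?_
        exact fun w hw => hsmul r r.2 w hw
      isClosed' := isClosed_closure }
  obtain ⟨f, hf, hfx⟩ := C.hyperplane_separation_point (x₀ := x) hxW
  have hfW : ∀ w ∈ W, 0 ≤ f w := fun w hw => hf w (subset_closure hw)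
  let re' : B →ₗ[ℝ] ℝ := f.toLinearMap ∘ₗ (selfAdjoint.submodule ℝ B).subtype ∘ₗ
    (realPart : B →ₗ[ℝ] selfAdjoint B)
  have hre : ∀ b : B, IsSelfAdjoint b → re' b = f b := by
    intro b hb
    change f ((realPart b : B)) = f b
    rw [hb.coe_realPart]
  let g : B →ₗ[ℂ] ℂ := Module.Dual.extendRCLike (𝕜 := ℂ) re'
  have hg : ∀ b, IsSelfAdjoint b → g b = f b := by
    intro b hb
    have h2 : re' ((Complex.I : ℂ) • b) = 0 := by
      change f ((realPart (Complex.I • b) : B)) = 0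
      rw [realPart_I_smul, hb.imaginaryPart]
      simp
    rw [show g b = (re' b : ℂ) - Complex.I * (re' ((Complex.I : ℂ) • b) : ℂ) from
      Module.Dual.extendRCLike_apply _ _, h2, hre b hb]
    simp
  refine ⟨g, fun a => ?_, fun w hw => ?_, ?_⟩
  · rw [hg _ (IsSelfAdjoint.star_mul_self a)]
    exact_mod_cast hfW _ (hpos a)
  · rw [hg _ (hsa w hw)]; exact_mod_cast hfW _ hw
  · rw [hg _ hx]; exact_mod_cast hfx

section
variable {A : Type*} [CStarAlgebra A] {H : Type*} [NormedAddCommGroup H] [InnerProductSpace ℂ H]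
  [CompleteSpace H] (π : A →⋆ₐ[ℂ] (H →L[ℂ] H))

theorem inner_rep_left (a : A) (v w : H) : ⟪π a v, w⟫_ℂ = ⟪v, π (star a) w⟫_ℂ := by
  rw [map_star, ContinuousLinearMap.star_eq_adjoint, ContinuousLinearMap.adjoint_inner_right]

theorem inner_rep_right (a : A) (v w : H) : ⟪v, π a w⟫_ℂ = ⟪π (star a) v, w⟫_ℂ := by
  rw [inner_rep_left, star_star]

theorem norm_rep_le (a : A) : ‖π a‖ ≤ ‖a‖ := NonUnitalStarAlgHom.norm_apply_le π a

theorem norm_inner_rep_le (a : A) (ξ : H) : ‖⟪ξ, π a ξ⟫_ℂ‖ ≤ ‖a‖ * ‖ξ‖ ^ 2 := by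
  calc ‖⟪ξ, π a ξ⟫_ℂ‖ ≤ ‖ξ‖ * ‖π a ξ‖ := norm_inner_le_norm _ _
    _ ≤ ‖ξ‖ * (‖a‖ * ‖ξ‖) := by
        gcongr
        exact (π a).le_of_opNorm_le (norm_rep_le π a) ξ
    _ = _ := by ring

theorem rep_mem_orthogonal {S : Submodule ℂ H} (hS : ∀ a : A, ∀ v ∈ S, π a v ∈ S) (a : A) {v : H}
    (hv : v ∈ Sᗮ) : π a v ∈ Sᗮ := by
  rw [Submodule.mem_orthogonal] at hv ⊢
  intro u hu
  rw [inner_rep_right]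
  exact hv _ (hS _ _ hu)

theorem eq_top_of_cyclic_mem {S : Submodule ℂ H} (hS : ∀ a : A, ∀ v ∈ S, π a v ∈ S)
    (hc : IsClosed (S : Set H)) {ξ : H} (hξ : DenseRange fun a => π a ξ) (h : ξ ∈ S) : S = ⊤ := by
  refine Submodule.eq_top_iff'.2 fun v => ?_
  refine hξ.induction_on (p := fun v => v ∈ S) v hc fun a => hS a ξ h
end

/-- The state space of `A`, as a subset of the function space `A → ℂ`. -/
def stateSet (A : Type) [CStarAlgebra A] : Set (A → ℂ) :=
  {ω | (∀ a b, ω (a + b) = ω a + ω b) ∧ (∀ (c : ℂ) a, ω (c • a) = c * ω a) ∧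
    (∀ a, 0 ≤ ω (star a * a)) ∧ ω 1 = 1}

section
variable {A : Type} [CStarAlgebra A]

/-- An element of the state space as a linear functional. -/
def stateSet.toLinearMap {ω : A → ℂ} (h : ω ∈ stateSet A) : A →ₗ[ℂ] ℂ where
  toFun := ω
  map_add' := h.1
  map_smul' := h.2.1

theorem norm_functional_le (g : A →ₗ[ℂ] ℂ) (hg : ∀ a, 0 ≤ g (star a * a)) (a : A) :
    ‖g a‖ ≤ ‖a‖ * ‖g 1‖ := by
  obtain ⟨H, _, _, _, π, ξ, h, -⟩ := exists_gns g hg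
  have h1 : ‖g 1‖ = ‖ξ‖ ^ 2 := by
    rw [h, map_one, one_apply_eq_self, inner_self_eq_norm_sq_to_K]
    simp
  rw [h1, h]
  exact norm_inner_rep_le π a ξ

theorem isCompact_stateSet : IsCompact (stateSet A) := by
  refine IsCompact.of_isClosed_subset
    (isCompact_univ_pi fun a : A => isCompact_closedBall (0 : ℂ) ‖a‖) ?_ ?_
  · have h1 : IsClosed {ω : A → ℂ | ∀ a b, ω (a + b) = ω a + ω b} := by
      simp only [Set.ofPred_forall]
      exact isClosed_iInter fun a => isClosed_iInter fun b =>
        isClosed_eq (by fun_prop) (by fun_prop)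
    have h2 : IsClosed {ω : A → ℂ | ∀ (c : ℂ) a, ω (c • a) = c * ω a} := by
      simp only [Set.ofPred_forall]
      exact isClosed_iInter fun a => isClosed_iInter fun b =>
        isClosed_eq (by fun_prop) (by fun_prop)
    have h3 : IsClosed {ω : A → ℂ | ∀ a, 0 ≤ ω (star a * a)} := by
      simp only [Set.ofPred_forall]
      exact isClosed_iInter fun a => isClosed_le (by fun_prop) (by fun_prop)
    have h4 : IsClosed {ω : A → ℂ | ω 1 = 1} := isClosed_eq (by fun_prop) (by fun_prop)
    exact h1.inter (h2.inter (h3.inter h4))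
  · intro ω hω a _
    have := norm_functional_le (stateSet.toLinearMap hω) hω.2.2.1 a
    have h1 : stateSet.toLinearMap hω 1 = 1 := hω.2.2.2
    rw [h1, norm_one, mul_one] at this
    exact mem_closedBall_zero_iff.2 this

/-- The GNS representation of an extreme state is irreducible. -/
theorem isIrreducibleRep_of_extreme {H : Type} [NormedAddCommGroup H] [InnerProductSpace ℂ H]
    [CompleteSpace H] (π : A →⋆ₐ[ℂ] (H →L[ℂ] H)) (ξ : H) (hξ : DenseRange fun a => π a ξ)
    (h1 : ‖ξ‖ = 1)
    (hex : ∀ ω₁ ∈ stateSet A, ∀ ω₂ ∈ stateSet A, ∀ t : ℝ, 0 < t → t < 1 →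
      (∀ a, ⟪ξ, π a ξ⟫_ℂ = t * ω₁ a + (1 - t) * ω₂ a) → ∀ a, ω₁ a = ⟪ξ, π a ξ⟫_ℂ) :
    IsIrreducibleRep (π : A →⋆ₙₐ[ℂ] (H →L[ℂ] H)) := by
  have hξ0 : ξ ≠ 0 := by rintro rfl; simp at h1
  refine ⟨⟨1, fun h => hξ0 ?_⟩, fun S hSc hS => ?_⟩
  · have h' : π 1 = 0 := h
    rw [map_one] at h'
    simpa using congrArg (fun T : H →L[ℂ] H => T ξ) h'
  replace hS : ∀ a : A, ∀ v ∈ S, π a v ∈ S := hS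
  have : CompleteSpace S := hSc.completeSpace_coe
  obtain ⟨ζ, hζ, ζ', hζ', hsum⟩ := Submodule.exists_add_mem_mem_orthogonal (K := S) ξ
  by_cases hz : ζ = 0
  · left
    have hmem : ξ ∈ Sᗮ := by rw [hsum, hz, zero_add]; exact hζ'
    have : Sᗮ = ⊤ := eq_top_of_cyclic_mem π (fun a v hv => rep_mem_orthogonal π hS a hv)
      (Submodule.isClosed_orthogonal S) hξ hmem
    rwa [Submodule.orthogonal_eq_top_iff] at this
  by_cases hz' : ζ' = 0
  · right
    exact eq_top_of_cyclic_mem π hS hSc hξ (by rw [hsum, hz', add_zero]; exact hζ)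
  exfalso
  have cross : ∀ a, ⟪ζ, π a ζ'⟫_ℂ = 0 := fun a =>
    (Submodule.mem_orthogonal _ _).1 (rep_mem_orthogonal π hS a hζ') _ hζ
  have cross' : ∀ a, ⟪ζ', π a ζ⟫_ℂ = 0 := fun a =>
    (Submodule.mem_orthogonal' _ _).1 hζ' _ (hS a _ hζ)
  have hzz : ⟪ζ, ζ'⟫_ℂ = 0 := by simpa using cross 1
  have hn : ‖ζ‖ ^ 2 + ‖ζ'‖ ^ 2 = 1 := by
    have := norm_add_sq_eq_norm_sq_add_norm_sq_of_inner_eq_zero ζ ζ' hzz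
    rw [← hsum, h1] at this
    nlinarith
  have hp : 0 < ‖ζ‖ ^ 2 := by positivity
  have hp' : 0 < ‖ζ'‖ ^ 2 := by positivity
  have state : ∀ v : H, v ≠ 0 → (fun a => ⟪v, π a v⟫_ℂ / ((‖v‖ ^ 2 : ℝ) : ℂ)) ∈ stateSet A := by
    intro v hv
    have hv' : ((‖v‖ ^ 2 : ℝ) : ℂ) ≠ 0 := by
      exact_mod_cast (pow_ne_zero 2 (norm_ne_zero_iff.2 hv))
    refine ⟨fun a b => ?_, fun c a => ?_, fun a => ?_, ?_⟩
    · simp [add_div]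
    · simp [mul_div_assoc]
    · have : ⟪v, π (star a * a) v⟫_ℂ = ((‖π a v‖ ^ 2 : ℝ) : ℂ) := by
        rw [map_mul, mul_apply_eq_comp, ← inner_rep_left, inner_self_eq_norm_sq_to_K]
        simp
      simp only [this]
      rw [← Complex.ofReal_div]
      exact_mod_cast (by positivity : 0 ≤ ‖π a v‖ ^ 2 / ‖v‖ ^ 2)
    · simp only [map_one, one_apply_eq_self]
      rw [inner_self_eq_norm_sq_to_K]
      field_simp
      simp
  have hsplit : ∀ a, ⟪ξ, π a ξ⟫_ℂ = ⟪ζ, π a ζ⟫_ℂ + ⟪ζ', π a ζ'⟫_ℂ := by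
    intro a
    rw [hsum]
    simp only [map_add, inner_add_left, inner_add_right, cross, cross']
    ring
  have key := hex _ (state ζ hz) _ (state ζ' hz') (‖ζ‖ ^ 2) hp (by linarith) (fun a => by
    have e : (1 : ℂ) - ((‖ζ‖ ^ 2 : ℝ) : ℂ) = ((‖ζ'‖ ^ 2 : ℝ) : ℂ) := by
      rw [sub_eq_iff_eq_add', ← Complex.ofReal_add, hn, Complex.ofReal_one]
    have e1 : ((‖ζ‖ ^ 2 : ℝ) : ℂ) ≠ 0 := by exact_mod_cast hp.ne'
    have e2 : ((‖ζ'‖ ^ 2 : ℝ) : ℂ) ≠ 0 := by exact_mod_cast hp'.ne'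
    rw [e, mul_div_cancel₀ _ e1, mul_div_cancel₀ _ e2, hsplit])
  have hperp : ∀ a, ⟪π a ξ, ζ - ((‖ζ‖ ^ 2 : ℝ) : ℂ) • ξ⟫_ℂ = 0 := by
    intro a
    have e1 : ((‖ζ‖ ^ 2 : ℝ) : ℂ) ≠ 0 := by exact_mod_cast hp.ne'
    have k := key (star a)
    rw [div_eq_iff e1] at k
    rw [inner_rep_left, map_sub, map_smul, inner_sub_right, inner_smul_right, mul_comm, ← k]
    nth_rw 1 [hsum]
    rw [inner_add_left, cross', add_zero, sub_self]
  have hzero : ζ - ((‖ζ‖ ^ 2 : ℝ) : ℂ) • ξ = 0 := by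
    refine hξ.eq_zero_of_inner_left (𝕜 := ℂ) fun a => ?_
    rw [← inner_conj_symm, hperp, map_zero]
  have h3 : ⟪ζ', ζ⟫_ℂ = ((‖ζ‖ ^ 2 : ℝ) : ℂ) * ((‖ζ'‖ ^ 2 : ℝ) : ℂ) := by
    rw [sub_eq_zero] at hzero
    nth_rw 1 [hzero]
    rw [inner_smul_right]
    congr 1
    rw [hsum, inner_add_right, ← inner_conj_symm, hzz, inner_self_eq_norm_sq_to_K]
    simp
  rw [← inner_conj_symm, hzz, map_zero] at h3
  have := mul_pos hp hp'
  exact this.ne (by exact_mod_cast h3)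

/-- If a positive functional is negative at `d`, then so is some vector state of an irreducible
representation with cyclic vector. -/
theorem exists_irreducible_of_functional_neg (g : A →ₗ[ℂ] ℂ) (hg : ∀ a, 0 ≤ g (star a * a)) (d : A)
    (hd : (g d).re < 0) :
    ∃ (H : Type) (_ : NormedAddCommGroup H) (_ : InnerProductSpace ℂ H) (_ : CompleteSpace H)
      (π : A →⋆ₐ[ℂ] (H →L[ℂ] H)) (ξ : H), IsIrreducibleRep (π : A →⋆ₙₐ[ℂ] (H →L[ℂ] H)) ∧
      (DenseRange fun a => π a ξ) ∧ (⟪ξ, π d ξ⟫_ℂ).re < 0 := by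
  have hg1 : g 1 ≠ 0 := by
    intro h
    have := norm_functional_le g hg d
    rw [h, norm_zero, mul_zero, norm_le_zero_iff] at this
    rw [this] at hd
    simp at hd
  have hg1' : 0 < g 1 := lt_of_le_of_ne (by simpa using hg 1) hg1.symm
  obtain ⟨r, hr, hrg⟩ : ∃ r : ℝ, 0 < r ∧ g 1 = r := by
    rw [Complex.lt_def] at hg1'
    exact ⟨(g 1).re, hg1'.1, Complex.ext rfl hg1'.2.symm⟩
  have hmem : (fun a => g a / r) ∈ stateSet A := by
    refine ⟨fun a b => by simp [add_div], fun c a => by simp [mul_div_assoc], fun a => ?_, ?_⟩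
    · exact div_nonneg (hg a) (by exact_mod_cast hr.le)
    · simp only [hrg]
      exact div_self (by exact_mod_cast hr.ne')
  obtain ⟨ω₀, hω₀, hmin⟩ := isCompact_stateSet.exists_isMinOn (s := stateSet A) ⟨_, hmem⟩
    (f := fun ω => (ω d).re) (Continuous.continuousOn (by fun_prop))
  have hneg : (ω₀ d).re < 0 := by
    refine lt_of_le_of_lt (hmin hmem) ?_
    simp only [Complex.div_ofReal_re]
    exact div_neg_of_neg_of_pos hd hr
  let F : Set (A → ℂ) := {ω ∈ stateSet A | (ω d).re = (ω₀ d).re}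
  have hF : IsCompact F := isCompact_stateSet.inter_right
    (isClosed_eq (f := fun ω : A → ℂ => (ω d).re) (by fun_prop) (by fun_prop))
  obtain ⟨ω, hω⟩ := hF.extremePoints_nonempty ⟨ω₀, hω₀, rfl⟩
  rw [mem_extremePoints] at hω
  obtain ⟨⟨hωs, hωd⟩, hext⟩ := hω
  obtain ⟨H, _, _, _, π, ξ, hπ, hξ⟩ := exists_gns (stateSet.toLinearMap hωs) hωs.2.2.1
  replace hπ : ∀ a, ω a = ⟪ξ, π a ξ⟫_ℂ := hπ
  refine ⟨H, _, _, _, π, ξ, ?_, hξ, by rw [← hπ, hωd]; exact hneg⟩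
  have hn : ‖ξ‖ = 1 := by
    have h := hπ 1
    rw [hωs.2.2.2, map_one, one_apply_eq_self, inner_self_eq_norm_sq_to_K] at h
    have h' : ‖ξ‖ ^ 2 = 1 := by
      apply Complex.ofReal_injective
      rw [Complex.ofReal_one, h]
      simp
    nlinarith [norm_nonneg ξ]
  refine isIrreducibleRep_of_extreme π ξ hξ hn fun ω₁ h₁ ω₂ h₂ t ht0 ht1 hsum => ?_
  have hsum' : ω = t • ω₁ + (1 - t) • ω₂ := by
    ext a
    rw [hπ, hsum]
    simp
  have hre : (ω₀ d).re = t * (ω₁ d).re + (1 - t) * (ω₂ d).re := by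
    rw [← hωd, hsum']
    simp
  have m1 : (ω₀ d).re ≤ (ω₁ d).re := hmin h₁
  have m2 : (ω₀ d).re ≤ (ω₂ d).re := hmin h₂
  have q1 : (ω₁ d).re = (ω₀ d).re := by nlinarith
  have q2 : (ω₂ d).re = (ω₀ d).re := by nlinarith
  have := (hext ω₁ ⟨h₁, q1⟩ ω₂ ⟨h₂, q2⟩ ⟨t, 1 - t, ht0, by linarith, by ring, hsum'.symm⟩).1
  intro a
  rw [this, hπ]

/-- Irreducible representations separate the points of a C*-algebra. -/
theorem exists_irreducible_ne_zero (c : A) (hc : c ≠ 0) :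
    ∃ (H : Type) (_ : NormedAddCommGroup H) (_ : InnerProductSpace ℂ H) (_ : CompleteSpace H)
      (π : A →⋆ₐ[ℂ] (H →L[ℂ] H)), IsIrreducibleRep (π : A →⋆ₙₐ[ℂ] (H →L[ℂ] H)) ∧ π c ≠ 0 := by
  let := CStarAlgebra.spectralOrder A
  have := CStarAlgebra.spectralOrderedRing A
  have hcl : closure {w : A | 0 ≤ w} = {w : A | 0 ≤ w} :=
    (isClosed_le (by fun_prop) (by fun_prop)).closure_eq
  obtain ⟨g, hg, -, hneg⟩ := exists_positive_separating {w : A | 0 ≤ w}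
    (fun w hw => IsSelfAdjoint.of_nonneg hw) (fun v hv w hw => show 0 ≤ v + w from add_nonneg hv hw)
    (fun r hr w hw => show 0 ≤ r • w from smul_nonneg hr hw) (fun b => star_mul_self_nonneg b)
    (-(star c * c))
    (IsSelfAdjoint.star_mul_self c).neg (by
      rw [hcl]
      intro h
      have h' : 0 ≤ -(star c * c) := h
      rw [neg_nonneg] at h'
      exact hc (CStarRing.star_mul_self_eq_zero_iff c |>.1
        (le_antisymm h' (star_mul_self_nonneg c))))
  obtain ⟨H, _, _, _, π, ξ, hirr, -, hπ⟩ := exists_irreducible_of_functional_neg g hg _ hneg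
  refine ⟨H, _, _, _, π, hirr, fun h => ?_⟩
  rw [map_neg, map_mul, h, mul_zero, neg_zero] at hπ
  simp at hπ
end

theorem isSubhomogeneous_continuousLinearMap {n : ℕ} {H : Type*} [NormedAddCommGroup H]
    [InnerProductSpace ℂ H] [CompleteSpace H] [FiniteDimensional ℂ H]
    (hH : Module.finrank ℂ H ≤ n) : IsSubhomogeneous n (H →L[ℂ] H) := by
  intro K _ _ _ π hπ
  obtain ⟨⟨T, hT⟩, hirr⟩ := hπ
  let b := stdOrthonormalBasis ℂ H
  have hTsum : T = ∑ q, InnerProductSpace.rankOne ℂ (T (b q)) (b q) := by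
    ext v
    conv_lhs => rw [← b.sum_repr' v]
    simp [InnerProductSpace.rankOne_apply]
  obtain ⟨q, hq⟩ : ∃ q, π (InnerProductSpace.rankOne ℂ (T (b q)) (b q)) ≠ 0 := by
    by_contra! h
    apply hT
    rw [hTsum, map_sum]
    exact Finset.sum_eq_zero fun q _ => h q
  obtain ⟨w, hw⟩ : ∃ w, π (InnerProductSpace.rankOne ℂ (T (b q)) (b q)) w ≠ 0 := by
    by_contra! h
    exact hq (ContinuousLinearMap.ext h)
  let L : H →ₗ[ℂ] K :=
    { toFun := fun v => π (InnerProductSpace.rankOne ℂ v (b q)) w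
      map_add' := fun u v => by simp
      map_smul' := fun c v => by simp }
  have hinv : ∀ a, ∀ v ∈ LinearMap.range L, π a v ∈ LinearMap.range L := by
    rintro a _ ⟨v, rfl⟩
    refine ⟨a v, ?_⟩
    change π (InnerProductSpace.rankOne ℂ (a v) (b q)) w =
      π a (π (InnerProductSpace.rankOne ℂ v (b q)) w)
    rw [← mul_apply_eq_comp, ← map_mul, ContinuousLinearMap.mul_def,
      InnerProductSpace.comp_rankOne]
  rcases hirr (LinearMap.range L) (Submodule.closed_of_finiteDimensional _) hinv with h | h
  · exfalso
    apply hw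
    have : L (T (b q)) ∈ LinearMap.range L := ⟨_, rfl⟩
    rw [h] at this
    exact this
  · have hs : Function.Surjective L := LinearMap.range_eq_top.1 h
    have : FiniteDimensional ℂ K := Module.Finite.of_surjective L hs
    rw [← Module.finrank_eq_rank]
    exact_mod_cast (LinearMap.finrank_le_finrank_of_surjective hs).trans hH

theorem isSubhomogeneous_of_subsingleton (n : ℕ) (F : Type*) [CStarAlgebra F] [Subsingleton F] :
    IsSubhomogeneous n F := by
  intro K _ _ _ π hπ
  obtain ⟨⟨a, ha⟩, -⟩ := hπ
  exact absurd (by rw [Subsingleton.elim a 0, map_zero]) ha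

theorem IsSubhomogeneous.prod {n : ℕ} {F₁ F₂ : Type*} [CStarAlgebra F₁] [CStarAlgebra F₂]
    (h₁ : IsSubhomogeneous n F₁) (h₂ : IsSubhomogeneous n F₂) : IsSubhomogeneous n (F₁ × F₂) := by
  intro K _ _ _ π hπ
  obtain ⟨⟨⟨a₀, b₀⟩, hne⟩, hirr⟩ := hπ
  have hsplit : ∀ a b, π (a, b) = π (a, 0) + π (0, b) := fun a b => by simp [← map_add]
  have hmul : ∀ x y v, π x (π y v) = π (x * y) v := fun x y v => by
    rw [map_mul, mul_apply_eq_comp]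
  by_cases hb : ∀ b, π (0, b) = 0
  · refine h₁ K (π.comp (NonUnitalStarAlgHom.inl ℂ F₁ F₂)) ⟨⟨a₀, ?_⟩, fun S hS hinv => ?_⟩
    · rw [hsplit, hb, add_zero] at hne
      exact hne
    · refine hirr S hS ?_
      rintro ⟨a, b⟩ v hv
      rw [hsplit, hb, add_zero]
      exact hinv a v hv
  push Not at hb
  obtain ⟨b₁, hb₁⟩ := hb
  obtain ⟨v, hv⟩ : ∃ v, π (0, b₁) v ≠ 0 := by
    by_contra! h
    exact hb₁ (ContinuousLinearMap.ext h)
  let S : Submodule ℂ K := ⨅ a : F₁, LinearMap.ker (π (a, 0)).toLinearMap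
  have hS : ∀ v, v ∈ S ↔ ∀ a, π (a, 0) v = 0 := fun v => by simp [S]
  have hScl : IsClosed (S : Set K) := by
    have : (S : Set K) = ⋂ a : F₁, {v | π (a, 0) v = 0} := by
      ext v
      simp [hS]
    rw [this]
    exact isClosed_iInter fun a => isClosed_eq (by fun_prop) (by fun_prop)
  rcases hirr S hScl (by
    rintro ⟨a, b⟩ v hv
    rw [hS] at hv ⊢
    intro a'
    rw [hmul, Prod.mk_mul_mk, zero_mul]
    exact hv _) with h | h
  · exfalso
    apply hv
    have : π (0, b₁) v ∈ S := by
      rw [hS]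
      intro a
      rw [hmul, Prod.mk_mul_mk, zero_mul, mul_zero]
      exact congrArg (fun T : K →L[ℂ] K => T v) (map_zero π)
    rw [h] at this
    exact this
  · have ha : ∀ a, π (a, 0) = 0 := fun a => by
      ext v
      have : v ∈ S := by rw [h]; trivial
      exact (hS v).1 this a
    refine h₂ K (π.comp (NonUnitalStarAlgHom.inr ℂ F₁ F₂)) ⟨⟨b₁, hb₁⟩, fun S hS hinv => ?_⟩
    refine hirr S hS ?_
    rintro ⟨a, b⟩ v hv
    rw [hsplit, ha, zero_add]
    exact hinv b v hv

theorem exists_star_mul_self_add {A : Type*} [CStarAlgebra A] (b c : A) :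
    ∃ d, star b * b + star c * c = star d * d := by
  let := CStarAlgebra.spectralOrder A
  have := CStarAlgebra.spectralOrderedRing A
  exact CStarAlgebra.nonneg_iff_eq_star_mul_self.1
    (add_nonneg (star_mul_self_nonneg b) (star_mul_self_nonneg c))

theorem IsPosElem.add {k : ℕ} {A : Type*} [CStarAlgebra A] {x y : Matrix (Fin k) (Fin k) A}
    (hx : IsPosElem x) (hy : IsPosElem y) : IsPosElem (x + y) := by
  let := CStarAlgebra.spectralOrder A
  have := CStarAlgebra.spectralOrderedRing A
  obtain ⟨b, rfl⟩ := hx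
  obtain ⟨c, rfl⟩ := hy
  obtain ⟨d, hd⟩ := exists_star_mul_self_add (CStarMatrix.ofMatrix b) (CStarMatrix.ofMatrix c)
  exact ⟨CStarMatrix.ofMatrix.symm d, hd⟩

theorem isPosElem_zero {R : Type*} [NonUnitalSemiring R] [StarRing R] : IsPosElem (0 : R) :=
  ⟨0, by simp⟩

theorem IsPosElem.sum {k : ℕ} {A ι : Type*} [CStarAlgebra A] (s : Finset ι)
    {x : ι → Matrix (Fin k) (Fin k) A} (hx : ∀ i, IsPosElem (x i)) :
    IsPosElem (∑ i ∈ s, x i) :=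
  Finset.sum_induction _ _ (fun _ _ => IsPosElem.add) isPosElem_zero fun i _ => hx i

theorem CompletelyPositive.add {A B : Type*} [CStarAlgebra A] [CStarAlgebra B] {φ ψ : A →ₗ[ℂ] B}
    (hφ : CompletelyPositive φ) (hψ : CompletelyPositive ψ) : CompletelyPositive (φ + ψ) := by
  intro k x hx
  exact (hφ k x hx).add (hψ k x hx)

theorem CompletelyPositive.comp_starAlgHom {A B C : Type*} [CStarAlgebra A] [CStarAlgebra B]
    [CStarAlgebra C] {φ : B →ₗ[ℂ] C} (hφ : CompletelyPositive φ) (π : A →⋆ₐ[ℂ] B) :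
    CompletelyPositive (φ ∘ₗ (π : A →ₐ[ℂ] B).toLinearMap) := by
  rintro k _ ⟨b, rfl⟩
  refine hφ k ((star b * b).map π) ⟨b.map π, ?_⟩
  ext i j
  simp [Matrix.mul_apply, Matrix.star_apply, map_star]

theorem CompletelyPositive.smul {A B : Type*} [CStarAlgebra A] [CStarAlgebra B] {φ : A →ₗ[ℂ] B}
    (hφ : CompletelyPositive φ) {r : ℝ} (hr : 0 ≤ r) : CompletelyPositive ((r : ℂ) • φ) := by
  intro k x hx
  obtain ⟨b, hb⟩ := hφ k x hx
  refine ⟨(Real.sqrt r : ℂ) • b, ?_⟩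
  have : (x.map ((r : ℂ) • φ)) = (r : ℂ) • x.map φ := by ext i j; simp
  rw [this, hb, star_smul, smul_mul_smul_comm]
  congr 1
  simp [← Complex.ofReal_mul, Real.mul_self_sqrt hr]

/-- The completely positive map `B(H) → A` attached to a basis of `H` and a row of elements
of `A`. -/
noncomputable def rowMap {A H ι : Type*} [CStarAlgebra A] [NormedAddCommGroup H]
    [InnerProductSpace ℂ H] [Fintype ι] (b : OrthonormalBasis ι ℂ H) (a : ι → A) :
    (H →L[ℂ] H) →ₗ[ℂ] A where
  toFun y := ∑ p, ∑ q, ⟪b p, y (b q)⟫_ℂ • (star (a p) * a q)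
  map_add' y z := by simp [add_smul, Finset.sum_add_distrib]
  map_smul' c y := by simp [Finset.smul_sum, mul_smul]

section
variable {A H ι : Type*} [CStarAlgebra A] [NormedAddCommGroup H] [InnerProductSpace ℂ H]
    [CompleteSpace H] [Fintype ι] (b : OrthonormalBasis ι ℂ H) (a : ι → A)

theorem rowMap_apply (y : H →L[ℂ] H) :
    rowMap b a y = ∑ p, ∑ q, ⟪b p, y (b q)⟫_ℂ • (star (a p) * a q) := rfl

theorem rowMap_star (y : H →L[ℂ] H) : rowMap b a (star y) = star (rowMap b a y) := by
  simp only [rowMap_apply, star_sum, star_smul, star_mul, star_star]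
  rw [Finset.sum_comm]
  refine Finset.sum_congr rfl fun p _ => Finset.sum_congr rfl fun q _ => ?_
  rw [ContinuousLinearMap.star_eq_adjoint, ContinuousLinearMap.adjoint_inner_right,
    ← inner_conj_symm]
  rfl

theorem completelyPositive_rowMap : CompletelyPositive (rowMap b a) := by
  rintro k _ ⟨B, rfl⟩
  have : (star B * B).map (rowMap b a) = ∑ r, star (Matrix.of fun l j =>
      ∑ q, ⟪b r, B l j (b q)⟫_ℂ • a q) *
        (Matrix.of fun l j => ∑ q, ⟪b r, B l j (b q)⟫_ℂ • a q) := by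
    ext i j
    simp only [Matrix.map_apply, Matrix.mul_apply, Matrix.sum_apply, Matrix.star_apply, map_sum,
      Matrix.of_apply, star_sum, star_smul]
    rw [Finset.sum_comm]
    refine Finset.sum_congr rfl fun l _ => ?_
    simp only [rowMap_apply, Finset.sum_mul_sum, smul_mul_smul_comm]
    conv_rhs => rw [Finset.sum_comm]
    refine Finset.sum_congr rfl fun p _ => ?_
    conv_rhs => rw [Finset.sum_comm]
    refine Finset.sum_congr rfl fun q _ => ?_
    rw [← Finset.sum_smul]
    congr 1
    rw [mul_apply_eq_comp, ContinuousLinearMap.star_eq_adjoint,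
      ContinuousLinearMap.adjoint_inner_right, ← b.sum_inner_mul_inner]
    refine Finset.sum_congr rfl fun r _ => ?_
    rw [← inner_conj_symm]
    rfl
  rw [this]
  exact IsPosElem.sum _ fun r => ⟨_, rfl⟩
end

/-- `T` factors as `*`-homomorphism followed by completely positive map through a
finite-dimensional `n`-subhomogeneous C*-algebra. -/
def FactorsThrough (n : ℕ) {A : Type} [CStarAlgebra A] (T : A → A) : Prop :=
  ∃ (F : Type) (_ : CStarAlgebra F) (φ : A →⋆ₐ[ℂ] F) (ψ : F →ₗ[ℂ] A), FiniteDimensional ℂ F ∧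
    IsSubhomogeneous n F ∧ CompletelyPositive ψ ∧ (∀ y, ψ (star y) = star (ψ y)) ∧
    ∀ x, T x = ψ (φ x)

section
variable {n : ℕ} {A : Type} [CStarAlgebra A]

theorem FactorsThrough.zero : FactorsThrough n (0 : A → A) := by
  let φ : A →⋆ₐ[ℂ] (Fin 0 → ℂ) :=
    { toFun := 0
      map_one' := Subsingleton.elim _ _
      map_mul' := fun _ _ => Subsingleton.elim _ _
      map_zero' := rfl
      map_add' := fun _ _ => Subsingleton.elim _ _
      commutes' := fun _ => Subsingleton.elim _ _
      map_star' := fun _ => Subsingleton.elim _ _ }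
  refine ⟨Fin 0 → ℂ, inferInstance, φ, 0, inferInstance,
    isSubhomogeneous_of_subsingleton _ _, fun k x _ => ?_, by simp, by simp⟩
  have : x.map (0 : (Fin 0 → ℂ) →ₗ[ℂ] A) = 0 := by ext; simp
  rw [this]
  exact isPosElem_zero

theorem FactorsThrough.add {S T : A → A} (hS : FactorsThrough n S) (hT : FactorsThrough n T) :
    FactorsThrough n (S + T) := by
  obtain ⟨F₁, _, φ₁, ψ₁, _, sub₁, cp₁, st₁, h₁⟩ := hS
  obtain ⟨F₂, _, φ₂, ψ₂, _, sub₂, cp₂, st₂, h₂⟩ := hT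
  refine ⟨F₁ × F₂, inferInstance, φ₁.prod φ₂, _, inferInstance, sub₁.prod sub₂,
    (cp₁.comp_starAlgHom (StarAlgHom.fst ℂ F₁ F₂)).add
      (cp₂.comp_starAlgHom (StarAlgHom.snd ℂ F₁ F₂)), fun y => ?_, fun x => ?_⟩
  · simp [st₁, st₂]
  · simp [h₁, h₂]

theorem FactorsThrough.smul {T : A → A} (hT : FactorsThrough n T) {r : ℝ} (hr : 0 ≤ r) :
    FactorsThrough n (r • T) := by
  obtain ⟨F, _, φ, ψ, hF, sub, cp, st, h⟩ := hT
  refine ⟨F, inferInstance, φ, _, hF, sub, cp.smul hr, fun y => ?_, fun x => ?_⟩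
  · simp [st]
  · simp [h]

theorem factorsThrough_rowMap {H ι : Type} [NormedAddCommGroup H] [InnerProductSpace ℂ H]
    [CompleteSpace H] [FiniteDimensional ℂ H] [Fintype ι] (hH : Module.finrank ℂ H ≤ n)
    (φ : A →⋆ₐ[ℂ] (H →L[ℂ] H)) (b : OrthonormalBasis ι ℂ H) (a : ι → A) :
    FactorsThrough n fun x => rowMap b a (φ x) :=
  ⟨H →L[ℂ] H, inferInstance, φ, rowMap b a, inferInstance,
    isSubhomogeneous_continuousLinearMap hH, completelyPositive_rowMap b a, rowMap_star b a,
    fun _ => rfl⟩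

theorem FactorsThrough.apply_star {T : A → A} (hT : FactorsThrough n T) (x : A) :
    T (star x) = star (T x) := by
  obtain ⟨F, _, φ, ψ, -, -, -, st, h⟩ := hT
  rw [h, h, map_star, st]
end

section
variable {A : Type} [CStarAlgebra A] {n : ℕ}

/-- A representation together with a commuting family of operators which jointly act
irreducibly. -/
structure JointlyIrreducible {S K : Type*} [NormedAddCommGroup K] [InnerProductSpace ℂ K]
    [CompleteSpace K] (π : A →⋆ₐ[ℂ] (K →L[ℂ] K)) (T : S → K →L[ℂ] K) : Prop where
  nontrivial : ∃ v : K, v ≠ 0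
  comm : ∀ s a v, T s (π a v) = π a (T s v)
  irreducible : ∀ V : Submodule ℂ K, IsClosed (V : Set K) → (∀ a, ∀ v ∈ V, π a v ∈ V) →
    (∀ s, ∀ v ∈ V, T s v ∈ V) → V = ⊥ ∨ V = ⊤

variable {S K : Type*} [NormedAddCommGroup K] [InnerProductSpace ℂ K]
    [CompleteSpace K] {π : A →⋆ₐ[ℂ] (K →L[ℂ] K)} {T : S → K →L[ℂ] K}

theorem JointlyIrreducible.prime (h : JointlyIrreducible π T) {a b : A}
    (hab : ∀ y, π (a * y * b) = 0) : π a = 0 ∨ π b = 0 := by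
  let V : Submodule ℂ K := ⨅ y : A, LinearMap.ker (π (a * y)).toLinearMap
  have hV : ∀ v, v ∈ V ↔ ∀ y, π (a * y) v = 0 := fun v => by simp [V]
  have hVcl : IsClosed (V : Set K) := by
    have : (V : Set K) = ⋂ y : A, {v | π (a * y) v = 0} := by
      ext v
      simp [V]
    rw [this]
    exact isClosed_iInter fun a => isClosed_eq (by fun_prop) (by fun_prop)
  rcases h.irreducible V hVcl (fun c v hv => by
      rw [hV] at hv ⊢
      intro y
      rw [← mul_apply_eq_comp, ← map_mul, mul_assoc]
      exact hv _) (fun s v hv => by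
      rw [hV] at hv ⊢
      intro y
      rw [← h.comm, hv, map_zero]) with h0 | h0
  · right
    ext v
    have : π b v ∈ V := by
      rw [hV]
      intro y
      rw [← mul_apply_eq_comp, ← map_mul, hab]
      rfl
    rw [h0] at this
    exact this
  · left
    ext v
    have : v ∈ V := by rw [h0]; trivial
    simpa using (hV v).1 this 1

theorem JointlyIrreducible.map_one_ne_zero (h : JointlyIrreducible π T) : π 1 ≠ 0 := by
  obtain ⟨v, hv⟩ := h.nontrivial
  intro h0
  apply hv
  rw [map_one] at h0
  simpa using congrArg (fun T : K →L[ℂ] K => T v) h0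

theorem JointlyIrreducible.exists_detecting (h : JointlyIrreducible π T) (G : Finset A)
    (hG : ∀ g ∈ G, π g ≠ 0) : ∃ c, π c ≠ 0 ∧
      ∀ (H : Type) [NormedAddCommGroup H] [InnerProductSpace ℂ H] [CompleteSpace H]
        (τ : A →⋆ₐ[ℂ] (H →L[ℂ] H)), τ c ≠ 0 → ∀ g ∈ G, τ g ≠ 0 := by
  classical
  induction G using Finset.induction_on with
  | empty => exact ⟨1, h.map_one_ne_zero, by simp⟩
  | insert g G _ ih =>
    obtain ⟨c, hc, hc'⟩ := ih fun g hg => hG g (Finset.mem_insert_of_mem hg)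
    obtain ⟨y, hy⟩ : ∃ y, π (g * y * c) ≠ 0 := by
      by_contra! h0
      rcases h.prime h0 with h1 | h1
      · exact hG g (Finset.mem_insert_self _ _) h1
      · exact hc h1
    refine ⟨g * y * c, hy, fun H _ _ _ τ hτ g' hg' => ?_⟩
    rw [map_mul, map_mul] at hτ
    rcases Finset.mem_insert.1 hg' with rfl | hg'
    · intro h0
      simp [h0] at hτ
    · exact hc' H τ (right_ne_zero_of_mul hτ) g' hg'

/-- A finite set of pairwise orthogonal self-adjoint elements not killed by `π`. -/
structure IsOrthogonalSet (π : A →⋆ₐ[ℂ] (K →L[ℂ] K)) (G : Finset A) : Prop where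
  isSelfAdjoint : ∀ g ∈ G, IsSelfAdjoint g
  ne_zero : ∀ g ∈ G, π g ≠ 0
  mul_eq_zero : ∀ g ∈ G, ∀ h ∈ G, g ≠ h → g * h = 0

theorem IsOrthogonalSet.card_le {G : Finset A} (hG : IsOrthogonalSet π G)
    (hA : IsSubhomogeneous n A) (h : JointlyIrreducible π T) : G.card ≤ n := by
  obtain ⟨c, hc, hc'⟩ := h.exists_detecting G hG.ne_zero
  obtain ⟨H, _, _, _, τ, hτ, hτc⟩ := exists_irreducible_ne_zero c (by rintro rfl; simp at hc)
  have hrank := hA H τ hτ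
  have hne : ∀ g : G, ∃ v, τ g v ≠ 0 := by
    intro g
    by_contra! h0
    exact hc' H τ hτc g g.2 (ContinuousLinearMap.ext h0)
  choose v hv using hne
  have hli : LinearIndependent ℂ fun g : G => τ g (v g) := by
    refine linearIndependent_of_ne_zero_of_inner_eq_zero hv fun g g' hgg' => ?_
    change ⟪τ g (v g), τ g' (v g')⟫_ℂ = 0
    rw [inner_rep_left, (hG.isSelfAdjoint g g.2).star_eq, ← mul_apply_eq_comp, ← map_mul,
      hG.mul_eq_zero g g.2 g' g'.2 (fun h => hgg' (Subtype.ext h)), map_zero]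
    simp
  have := hli.cardinal_le_rank.trans hrank
  simpa using this

theorem exists_maximal_isOrthogonalSet (hA : IsSubhomogeneous n A) (h : JointlyIrreducible π T) :
    ∃ G, IsOrthogonalSet π G ∧ G.Nonempty ∧ ∀ G', IsOrthogonalSet π G' → G'.card ≤ G.card := by
  let N : Set ℕ := {m | ∃ G, IsOrthogonalSet π G ∧ G.card = m}
  have hbdd : BddAbove N := ⟨n, by rintro _ ⟨G, hG, rfl⟩; exact hG.card_le hA h⟩
  have h1 : IsOrthogonalSet π {1} := by
    refine ⟨?_, ?_, ?_⟩
    · simp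
    · simpa using h.map_one_ne_zero
    · simp
  have hne : N.Nonempty := ⟨1, {1}, h1, by simp⟩
  obtain ⟨G, hG, hcard⟩ := Nat.sSup_mem hne hbdd
  have hmax : ∀ G', IsOrthogonalSet π G' → G'.card ≤ G.card := fun G' hG' => by
    rw [hcard]
    exact le_csSup hbdd ⟨G', hG', rfl⟩
  refine ⟨G, hG, ?_, hmax⟩
  rw [← Finset.card_pos]
  exact lt_of_lt_of_le (by simp) (hmax _ h1)

theorem eq_zero_of_isSelfAdjoint_of_mul_self {B : Type*} [CStarAlgebra B] {a : B}
    (ha : IsSelfAdjoint a) (h : a * a = 0) : a = 0 := by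
  rw [← CStarRing.star_mul_self_eq_zero_iff, ha.star_eq, h]

theorem posPart_mul_eq_zero {z g : A} (hz : IsSelfAdjoint z) (h : z * g = 0) : z⁺ * g = 0 := by
  let := CStarAlgebra.spectralOrder A
  have := CStarAlgebra.spectralOrderedRing A
  have hp : IsSelfAdjoint z⁺ := IsSelfAdjoint.of_nonneg (CFC.posPart_nonneg z)
  rw [← CStarRing.star_mul_self_eq_zero_iff, star_mul, hp.star_eq, mul_assoc, ← mul_assoc z⁺]
  have : z⁺ * z⁺ = z⁺ * z := by
    calc z⁺ * z⁺ = z⁺ * (z⁺ - z⁻) := by rw [mul_sub, CFC.posPart_mul_negPart, sub_zero]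
      _ = z⁺ * z := by rw [CFC.posPart_sub_negPart z hz]
  rw [this, mul_assoc, h, mul_zero, mul_zero]

theorem posPart_or_negPart_eq_zero {G : Finset A} (hG : IsOrthogonalSet π G)
    (hmax : ∀ G', IsOrthogonalSet π G' → G'.card ≤ G.card) {g : A} (hg : g ∈ G) {z : A}
    (hz : IsSelfAdjoint z) (hzG : ∀ h ∈ G, h ≠ g → z * h = 0) : π z⁺ = 0 ∨ π z⁻ = 0 := by
  classical
  let := CStarAlgebra.spectralOrder A
  have := CStarAlgebra.spectralOrderedRing A
  have sp : IsSelfAdjoint z⁺ := IsSelfAdjoint.of_nonneg (CFC.posPart_nonneg z)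
  have sn : IsSelfAdjoint z⁻ := IsSelfAdjoint.of_nonneg (CFC.negPart_nonneg z)
  have op : ∀ h ∈ G, h ≠ g → z⁺ * h = 0 := fun h hh hne => posPart_mul_eq_zero hz (hzG h hh hne)
  have on : ∀ h ∈ G, h ≠ g → z⁻ * h = 0 := fun h hh hne => by
    rw [← CFC.posPart_neg]
    exact posPart_mul_eq_zero hz.neg (by rw [neg_mul, hzG h hh hne, neg_zero])
  have flip : ∀ {a b : A}, IsSelfAdjoint a → IsSelfAdjoint b → a * b = 0 → b * a = 0 := by
    intro a b ha hb hab
    rw [← ha.star_eq, ← hb.star_eq, ← star_mul, hab, star_zero]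
  by_contra! hcon
  obtain ⟨np, nn⟩ := hcon
  have nz : ∀ {a : A}, IsSelfAdjoint a → π a ≠ 0 → a * a ≠ 0 := by
    intro a ha hπ h0
    rw [eq_zero_of_isSelfAdjoint_of_mul_self ha h0, map_zero] at hπ
    exact hπ rfl
  have pn : z⁺ * z⁻ = 0 := CFC.posPart_mul_negPart z
  have hpn : z⁺ ≠ z⁻ := fun h => nz sp np (by nth_rw 2 [h]; exact pn)
  have hnG : z⁻ ∉ G.erase g := fun h => by
    obtain ⟨h1, h2⟩ := Finset.mem_erase.1 h
    exact nz sn nn (on _ h2 h1)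
  have hpG : z⁺ ∉ insert z⁻ (G.erase g) := fun h => by
    rcases Finset.mem_insert.1 h with h | h
    · exact hpn h
    obtain ⟨h1, h2⟩ := Finset.mem_erase.1 h
    exact nz sp np (op _ h2 h1)
  have hfam : IsOrthogonalSet π (insert z⁺ (insert z⁻ (G.erase g))) := by
    refine ⟨?_, ?_, ?_⟩
    · simp only [Finset.mem_insert, Finset.mem_erase]
      rintro a (rfl | rfl | ⟨-, h⟩)
      exacts [sp, sn, hG.isSelfAdjoint a h]
    · simp only [Finset.mem_insert, Finset.mem_erase]
      rintro a (rfl | rfl | ⟨-, h⟩)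
      exacts [np, nn, hG.ne_zero a h]
    · simp only [Finset.mem_insert, Finset.mem_erase]
      rintro a (rfl | rfl | ⟨h1, h⟩) b (rfl | rfl | ⟨h2, h'⟩) hab
      · exact absurd rfl hab
      · exact pn
      · exact op b h' h2
      · exact flip sp sn pn
      · exact absurd rfl hab
      · exact on b h' h2
      · exact flip sp (hG.isSelfAdjoint a h) (op a h h1)
      · exact flip sn (hG.isSelfAdjoint a h) (on a h h1)
      · exact hG.mul_eq_zero a h b h' hab
  have := hmax _ hfam
  rw [Finset.card_insert_of_notMem hpG, Finset.card_insert_of_notMem hnG,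
    Finset.card_erase_of_mem hg] at this
  have := Finset.card_pos.2 ⟨g, hg⟩
  omega

theorem re_inner_rep_nonneg [PartialOrder A] [StarOrderedRing A] (π : A →⋆ₐ[ℂ] (K →L[ℂ] K)) {a : A}
    (ha : 0 ≤ a) (v : K) : 0 ≤ (⟪v, π a v⟫_ℂ).re := by
  obtain ⟨b, rfl⟩ := CStarAlgebra.nonneg_iff_eq_star_mul_self.1 ha
  rw [map_mul, mul_apply_eq_comp, ← inner_rep_left]
  exact inner_self_nonneg (𝕜 := ℂ)

theorem re_inner_nonneg_or_nonpos {G : Finset A} (hG : IsOrthogonalSet π G)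
    (hmax : ∀ G', IsOrthogonalSet π G' → G'.card ≤ G.card) {g : A} (hg : g ∈ G) {z : A}
    (hz : IsSelfAdjoint z) (hzG : ∀ h ∈ G, h ≠ g → z * h = 0) :
    (∀ v, 0 ≤ (⟪v, π z v⟫_ℂ).re) ∨ (∀ v, (⟪v, π z v⟫_ℂ).re ≤ 0) := by
  let := CStarAlgebra.spectralOrder A
  have := CStarAlgebra.spectralOrderedRing A
  have hsub := CFC.posPart_sub_negPart z hz
  rcases posPart_or_negPart_eq_zero hG hmax hg hz hzG with h | h
  · right
    intro v
    rw [← hsub, map_sub, h, zero_sub]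
    simpa using re_inner_rep_nonneg π (CFC.negPart_nonneg z) v
  · left
    intro v
    rw [← hsub, map_sub, h, sub_zero]
    exact re_inner_rep_nonneg π (CFC.posPart_nonneg z) v

theorem exists_real_compression {G : Finset A} (hG : IsOrthogonalSet π G)
    (hmax : ∀ G', IsOrthogonalSet π G' → G'.card ≤ G.card) {g : A} (hg : g ∈ G) {y : A}
    (hy : IsSelfAdjoint y) : ∃ t : ℝ, π (g * y * g) = (t : ℂ) • π (g * g) := by
  have hgs := hG.isSelfAdjoint g hg
  obtain ⟨v₀, hv₀⟩ : ∃ v, π g v ≠ 0 := by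
    by_contra! h0
    exact hG.ne_zero g hg (ContinuousLinearMap.ext h0)
  have hr : ∀ v, (⟪v, π (g * g) v⟫_ℂ).re = ‖π g v‖ ^ 2 := fun v => by
    rw [map_mul, mul_apply_eq_comp, inner_rep_right, hgs.star_eq, inner_self_eq_norm_sq_to_K]
    simp [← Complex.ofReal_pow]
  have alt : ∀ t : ℝ, (∀ v, t * ‖π g v‖ ^ 2 ≤ (⟪v, π (g * y * g) v⟫_ℂ).re) ∨
      (∀ v, (⟪v, π (g * y * g) v⟫_ℂ).re ≤ t * ‖π g v‖ ^ 2) := by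
    intro t
    have hz : IsSelfAdjoint (g * y * g - (t : ℂ) • (g * g)) := by
      simp [IsSelfAdjoint, hgs.star_eq, hy.star_eq, mul_assoc]
    have hexp : ∀ v, (⟪v, π (g * y * g - (t : ℂ) • (g * g)) v⟫_ℂ).re =
        (⟪v, π (g * y * g) v⟫_ℂ).re - t * ‖π g v‖ ^ 2 := by
      intro v
      rw [← hr, map_sub, map_smul, sub_apply, smul_apply, inner_sub_right, inner_smul_right]
      simp
    rcases re_inner_nonneg_or_nonpos hG hmax hg hz (fun h hh hne => by
      have := hG.mul_eq_zero g hg h hh hne.symm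
      simp [sub_mul, mul_assoc, this]) with h | h
    · left
      intro v
      have := h v
      rw [hexp] at this
      linarith
    · right
      intro v
      have := h v
      rw [hexp] at this
      linarith
  have hpos : 0 < ‖π g v₀‖ ^ 2 := by positivity
  set t₀ := (⟪v₀, π (g * y * g) v₀⟫_ℂ).re / ‖π g v₀‖ ^ 2 with ht₀
  have heq : (⟪v₀, π (g * y * g) v₀⟫_ℂ).re = t₀ * ‖π g v₀‖ ^ 2 := by
    rw [ht₀]; field_simp
  have lower : ∀ v, t₀ * ‖π g v‖ ^ 2 ≤ (⟪v, π (g * y * g) v⟫_ℂ).re := by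
    intro v
    refine le_of_forall_pos_le_add fun ε hε => ?_
    obtain ⟨δ, hδ, hδ'⟩ : ∃ δ > 0, δ * ‖π g v‖ ^ 2 ≤ ε :=
      ⟨ε / (‖π g v‖ ^ 2 + 1), by positivity, by
        rw [div_mul_eq_mul_div, div_le_iff₀ (by positivity)]; nlinarith⟩
    rcases alt (t₀ - δ) with h | h
    · nlinarith [h v]
    · nlinarith [h v₀, mul_pos hδ hpos]
  have upper : ∀ v, (⟪v, π (g * y * g) v⟫_ℂ).re ≤ t₀ * ‖π g v‖ ^ 2 := by
    intro v
    refine le_of_forall_pos_le_add fun ε hε => ?_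
    obtain ⟨δ, hδ, hδ'⟩ : ∃ δ > 0, δ * ‖π g v‖ ^ 2 ≤ ε :=
      ⟨ε / (‖π g v‖ ^ 2 + 1), by positivity, by
        rw [div_mul_eq_mul_div, div_le_iff₀ (by positivity)]; nlinarith⟩
    rcases alt (t₀ + δ) with h | h
    · nlinarith [h v₀, mul_pos hδ hpos]
    · nlinarith [h v]
  refine ⟨t₀, ?_⟩
  rw [← sub_eq_zero, ← map_smul, ← map_sub]
  have hz : IsSelfAdjoint (g * y * g - (t₀ : ℂ) • (g * g)) := by
    simp [IsSelfAdjoint, hgs.star_eq, hy.star_eq, mul_assoc]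
  have key : ∀ v, ⟪v, π (g * y * g - (t₀ : ℂ) • (g * g)) v⟫_ℂ = 0 := by
    intro v
    apply Complex.ext
    · rw [map_sub, map_smul, sub_apply, smul_apply, inner_sub_right, inner_smul_right,
        Complex.sub_re, Complex.re_ofReal_mul, hr]
      simpa using sub_eq_zero.2 (le_antisymm (upper v) (lower v))
    · have := inner_conj_symm (𝕜 := ℂ) v (π (g * y * g - (t₀ : ℂ) • (g * g)) v)
      rw [inner_rep_left, hz.star_eq] at this
      exact Complex.conj_eq_iff_im.1 this
  have := (inner_map_self_eq_zero (π (g * y * g - (t₀ : ℂ) • (g * g))).toLinearMap).1 (fun v => by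
    rw [← inner_conj_symm]
    exact (congrArg _ (key v)).trans (map_zero _))
  ext v
  exact congrArg (fun L : K →ₗ[ℂ] K => L v) this

/-- The image of `A` in a jointly irreducible representation contains a minimal projection. -/
theorem exists_minimal_projection (hA : IsSubhomogeneous n A) (h : JointlyIrreducible π T) :
    ∃ e, IsSelfAdjoint e ∧ π (e * e) = π e ∧ π e ≠ 0 ∧ ∀ y, ∃ c : ℂ, π (e * y * e) = c • π e := by
  obtain ⟨G, hG, ⟨g, hg⟩, hmax⟩ := exists_maximal_isOrthogonalSet hA h
  have hgs := hG.isSelfAdjoint g hg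
  obtain ⟨t, ht⟩ := exists_real_compression hG hmax hg hgs
  have hgs' : IsSelfAdjoint (π g) := hgs.map π
  have hsq : π g * π g = (t : ℂ) • π g := by
    rw [← sub_eq_zero]
    refine eq_zero_of_isSelfAdjoint_of_mul_self ?_ ?_
    · simp [IsSelfAdjoint, hgs'.star_eq]
    · have h3 : π g * π g * π g = (t : ℂ) • (π g * π g) := by simpa using ht
      simp only [mul_sub, sub_mul, smul_mul_assoc, mul_smul_comm, ← mul_assoc, h3]
      simp
  have ht0 : t ≠ 0 := by
    rintro rfl
    exact hG.ne_zero g hg (eq_zero_of_isSelfAdjoint_of_mul_self hgs' (by simpa using hsq))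
  have ht0' : (t : ℂ) ≠ 0 := by exact_mod_cast ht0
  refine ⟨((t⁻¹ : ℝ) : ℂ) • g, ?_, ?_, ?_, fun y => ?_⟩
  · simp [IsSelfAdjoint, hgs.star_eq]
  · simp only [map_mul, map_smul, smul_mul_smul_comm, hsq, smul_smul]
    congr 1
    push_cast
    field_simp
  · rw [map_smul]
    exact smul_ne_zero (by exact_mod_cast inv_ne_zero ht0) (hG.ne_zero g hg)
  · obtain ⟨a, ha⟩ := exists_real_compression hG hmax hg (realPart y).2
    obtain ⟨b, hb⟩ := exists_real_compression hG hmax hg (imaginaryPart y).2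
    refine ⟨((t⁻¹ : ℝ) : ℂ) * (a + Complex.I * b) * t, ?_⟩
    have hy : π (g * y * g) = ((a : ℂ) + Complex.I * b) • π (g * g) := by
      conv_lhs => rw [← realPart_add_I_smul_imaginaryPart y]
      rw [mul_add, add_mul, map_add, ha, mul_smul_comm, smul_mul_assoc, map_smul, hb, add_smul,
        smul_smul]
    rw [smul_mul_assoc, smul_mul_assoc, mul_smul_comm, map_smul, map_smul, hy, map_mul, hsq,
      map_smul]
    simp only [smul_smul]
    congr 1
    ring
end

section
variable {A : Type} [CStarAlgebra A] {n : ℕ} {S : Type*} {K : Type*} [NormedAddCommGroup K]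
  [InnerProductSpace ℂ K] [CompleteSpace K] {π : A →⋆ₐ[ℂ] (K →L[ℂ] K)} {T : S → K →L[ℂ] K}

/-- A jointly irreducible representation of a subhomogeneous algebra is a multiple of a
finite-dimensional one. -/
theorem exists_finiteDimensional_amplification (hA : IsSubhomogeneous n A)
    (h : JointlyIrreducible π T) :
    ∃ (H : Type) (_ : NormedAddCommGroup H) (_ : InnerProductSpace ℂ H) (_ : CompleteSpace H)
      (_ : FiniteDimensional ℂ H) (φ : A →⋆ₐ[ℂ] (H →L[ℂ] H)) (ξ₀ : H) (e : A),
      Module.finrank ℂ H ≤ n ∧ (Function.Surjective fun a => φ a ξ₀) ∧ IsSelfAdjoint e ∧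
      π (e * e) = π e ∧ π e ≠ 0 ∧ ∀ y, π (e * y * e) = ⟪ξ₀, φ y ξ₀⟫_ℂ • π e := by
  obtain ⟨e, he, hee, he0, hey⟩ := exists_minimal_projection hA h
  have hee' : ∀ v, π e (π e v) = π e v := fun v => by rw [← mul_apply_eq_comp, ← map_mul, hee]
  obtain ⟨ζ, hζ1, hζ⟩ : ∃ ζ, ‖ζ‖ = 1 ∧ π e ζ = ζ := by
    obtain ⟨v, hv⟩ : ∃ v, π e v ≠ 0 := by
      by_contra! h0
      exact he0 (ContinuousLinearMap.ext h0)
    refine ⟨((‖π e v‖⁻¹ : ℝ) : ℂ) • π e v, ?_, ?_⟩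
    · rw [norm_smul]
      simp [norm_ne_zero_iff.2 hv]
    · rw [map_smul, hee']
  let f : A →ₗ[ℂ] ℂ :=
    { toFun := fun y => ⟪ζ, π y ζ⟫_ℂ
      map_add' := fun x y => by simp
      map_smul' := fun c x => by simp }
  have hf : ∀ y, f y = ⟪ζ, π y ζ⟫_ℂ := fun _ => rfl
  have hfe : ∀ y, π (e * y * e) = f y • π e := by
    intro y
    obtain ⟨c, hc⟩ := hey y
    have h1 : ⟪ζ, π (e * y * e) ζ⟫_ℂ = f y := by
      rw [map_mul, map_mul, mul_apply_eq_comp, mul_apply_eq_comp, inner_rep_right, he.star_eq, hζ,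
        hf]
    rw [hc, smul_apply, hζ, inner_smul_right, inner_self_eq_norm_sq_to_K, hζ1] at h1
    rw [hc, ← h1]
    simp
  obtain ⟨H, _, _, _, φ, ξ₀, hφ, hdense⟩ := exists_gns f fun a => by
    rw [hf, map_mul, mul_apply_eq_comp, ← inner_rep_left]
    rw [inner_self_eq_norm_sq_to_K]
    exact pow_nonneg (by simp) 2
  have hzero : ∀ a, π a ζ = 0 → φ a ξ₀ = 0 := by
    intro a ha
    rw [← inner_self_eq_zero (𝕜 := ℂ), inner_rep_left, ← mul_apply_eq_comp, ← map_mul, ← hφ, hf,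
      map_mul, mul_apply_eq_comp, ha, map_zero, inner_zero_right]
  have hrank1 : ∀ v, φ e v = ⟪ξ₀, v⟫_ℂ • ξ₀ := by
    intro v
    refine hdense.induction_on (p := fun v => φ e v = ⟪ξ₀, v⟫_ℂ • ξ₀) v
      (isClosed_eq (by fun_prop) (by fun_prop)) fun b => ?_
    have := hzero (e * b - f b • 1) (by
      have h1 : π (e * b) ζ = f b • ζ := by
        calc π (e * b) ζ = π (e * b * e) ζ := by
              rw [map_mul _ (e * b), mul_apply_eq_comp, hζ]
          _ = f b • ζ := by rw [hfe, smul_apply, hζ]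
      rw [map_sub, sub_apply, h1, map_smul, map_one]
      simp)
    rw [map_sub, map_smul, map_one, map_mul, sub_apply, sub_eq_zero, mul_apply_eq_comp] at this
    rw [this, ← hφ]
    simp
  have hξ0 : ξ₀ ≠ 0 := by
    intro h0
    have h1 := hφ 1
    rw [h0, inner_zero_left, hf, map_one, one_apply_eq_self, inner_self_eq_norm_sq_to_K, hζ1] at h1
    simp at h1
  have hirr : IsIrreducibleRep (φ : A →⋆ₙₐ[ℂ] (H →L[ℂ] H)) := by
    refine ⟨⟨1, fun h1 => hξ0 ?_⟩, fun V hV hinv => ?_⟩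
    · have h1' : φ 1 = 0 := h1
      rw [map_one] at h1'
      simpa using congrArg (fun T : H →L[ℂ] H => T ξ₀) h1'
    replace hinv : ∀ a : A, ∀ v ∈ V, φ a v ∈ V := hinv
    by_cases hbot : V = ⊥
    · exact Or.inl hbot
    right
    obtain ⟨w, hw, hw0⟩ := V.ne_bot_iff.1 hbot
    obtain ⟨b, hb⟩ : ∃ b, ⟪ξ₀, φ b w⟫_ℂ ≠ 0 := by
      by_contra! h0
      refine hw0 (hdense.eq_zero_of_inner_right (𝕜 := ℂ) fun a => ?_)
      rw [inner_rep_left]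
      exact h0 _
    refine eq_top_of_cyclic_mem φ hinv hV hdense ?_
    have := hinv e _ (hinv b w hw)
    rw [hrank1] at this
    exact (V.smul_mem_iff hb).1 this
  have hrank := hA H φ hirr
  have hfd : FiniteDimensional ℂ H := by
    rw [FiniteDimensional, ← Module.rank_lt_aleph0_iff]
    exact lt_of_le_of_lt hrank (Cardinal.natCast_lt_aleph0)
  refine ⟨H, inferInstance, inferInstance, inferInstance, hfd, φ, ξ₀, e, ?_, ?_, he, hee, he0,
    fun y => by rw [hfe, hφ]⟩
  · exact_mod_cast (Module.finrank_eq_rank ℂ H) ▸ hrank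
  · let L : A →ₗ[ℂ] H :=
      { toFun := fun a => φ a ξ₀
        map_add' := fun x y => by simp
        map_smul' := fun c x => by simp }
    have : LinearMap.range L = ⊤ := by
      rw [← SetLike.coe_set_eq, ← (Submodule.closed_of_finiteDimensional _).closure_eq]
      exact hdense.closure_range
    exact LinearMap.range_eq_top.1 this

variable [Fintype S]

/-- Positivity of `∑ s, φ (x s) ⊗ T s` for all representations `φ` of dimension at most `n`. -/
def PositiveOnReps (n : ℕ) (x : S → A) (T : S → K →L[ℂ] K) : Prop :=
  ∀ (H : Type) [NormedAddCommGroup H] [InnerProductSpace ℂ H] [CompleteSpace H]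
    [FiniteDimensional ℂ H] (φ : A →⋆ₐ[ℂ] (H →L[ℂ] H)), Module.finrank ℂ H ≤ n →
    ∀ (m : ℕ) (b : OrthonormalBasis (Fin m) ℂ H) (η : Fin m → K),
      0 ≤ (∑ s, ∑ p, ∑ q, ⟪b p, φ (x s) (b q)⟫_ℂ * ⟪η p, T s (η q)⟫_ℂ).re

theorem re_sum_inner_nonneg (hA : IsSubhomogeneous n A) (h : JointlyIrreducible π T) (x : S → A)
    (hpos : PositiveOnReps n x T) (η : K) :
    0 ≤ (∑ s, ⟪η, π (x s) (T s η)⟫_ℂ).re := by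
  obtain ⟨H, _, _, _, _, φ, ξ₀, e, hH, hsurj, he, hee, he0, hey⟩ :=
    exists_finiteDimensional_amplification hA h
  have hee' : ∀ v, π e (π e v) = π e v := fun v => by rw [← mul_apply_eq_comp, ← map_mul, hee]
  let b := stdOrthonormalBasis ℂ H
  choose a ha using fun i => hsurj (b i)
  replace ha : ∀ i, φ (a i) ξ₀ = b i := ha
  have hinner : ∀ c d u v, ⟪π c (π e u), π d (π e v)⟫_ℂ =
      ⟪φ c ξ₀, φ d ξ₀⟫_ℂ * ⟪π e u, π e v⟫_ℂ := by
    intro c d u v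
    have : π e (π (star c) (π d (π e v))) = ⟪φ c ξ₀, φ d ξ₀⟫_ℂ • π e v := by
      rw [inner_rep_left, ← mul_apply_eq_comp (φ _), ← map_mul, ← smul_apply, ← hey]
      simp [mul_assoc]
    rw [inner_rep_left, ← hee' u, inner_rep_left, he.star_eq, this, inner_smul_right, hee']
  have hexpand : ∀ c u, π c (π e u) = ∑ i, ⟪b i, φ c ξ₀⟫_ℂ • π (a i) (π e u) := by
    intro c u
    have h0 : φ (c - ∑ i, ⟪b i, φ c ξ₀⟫_ℂ • a i) ξ₀ = 0 := by
      simp only [map_sub, map_sum, map_smul, sub_apply, sum_apply, smul_apply, ha]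
      rw [b.sum_repr', sub_self]
    have h1 := hinner (c - ∑ i, ⟪b i, φ c ξ₀⟫_ℂ • a i) (c - ∑ i, ⟪b i, φ c ξ₀⟫_ℂ • a i) u u
    rw [h0, inner_zero_left, zero_mul, inner_self_eq_zero] at h1
    simp only [map_sub, map_sum, map_smul, sub_apply, sum_apply, smul_apply] at h1
    exact sub_eq_zero.1 h1
  let L : (Fin (Module.finrank ℂ H) → K) →ₗ[ℂ] K :=
    { toFun := fun u => ∑ i, π (a i) (π e (u i))
      map_add' := fun u v => by simp [Finset.sum_add_distrib]
      map_smul' := fun c u => by simp [Finset.smul_sum] }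
  have hL : ∀ u, L u = ∑ i, π (a i) (π e (u i)) := fun _ => rfl
  let V : Submodule ℂ K := LinearMap.range L
  have hmem : ∀ c u, π c (π e u) ∈ V := fun c u => by
    refine ⟨fun i => ⟪b i, φ c ξ₀⟫_ℂ • u, ?_⟩
    rw [hL, hexpand]
    simp
  have hVπ : ∀ c, ∀ v ∈ V, π c v ∈ V := by
    rintro c _ ⟨u, rfl⟩
    rw [hL, map_sum]
    refine V.sum_mem fun i _ => ?_
    rw [← mul_apply_eq_comp, ← map_mul]
    exact hmem _ _
  have hVT : ∀ s, ∀ v ∈ V, T s v ∈ V := by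
    rintro s _ ⟨u, rfl⟩
    rw [hL, map_sum]
    refine V.sum_mem fun i _ => ?_
    rw [h.comm, h.comm]
    exact hmem _ _
  have hdense : V.topologicalClosure = ⊤ := by
    refine (h.irreducible V.topologicalClosure V.isClosed_topologicalClosure
      (fun c v hv => ?_) (fun s v hv => ?_)).resolve_left fun hbot => he0 ?_
    · exact map_mem_closure (π c).continuous hv (hVπ c)
    · exact map_mem_closure (T s).continuous hv (hVT s)
    · ext v
      have : π 1 (π e v) ∈ V.topologicalClosure := V.le_topologicalClosure (hmem 1 v)
      rw [hbot, map_one] at this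
      exact this
  have hη : η ∈ closure (V : Set K) := by
    rw [← Submodule.topologicalClosure_coe, hdense]
    trivial
  refine closure_minimal (s := (V : Set K))
    (t := {η | 0 ≤ (∑ s, ⟪η, π (x s) (T s η)⟫_ℂ).re}) ?_
    (isClosed_le (by fun_prop) (by fun_prop)) hη
  rintro _ ⟨u, rfl⟩
  refine (hpos H φ hH _ b fun i => π e (u i)).trans_eq (congrArg Complex.re ?_)
  refine Finset.sum_congr rfl fun s _ => ?_
  simp only [hL, map_sum, sum_inner, inner_sum]
  rw [Finset.sum_comm]
  refine Finset.sum_congr rfl fun p _ => Finset.sum_congr rfl fun q _ => ?_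
  rw [h.comm, h.comm, h.comm, ← mul_apply_eq_comp (π (x s)), ← map_mul, hinner, map_mul,
    mul_apply_eq_comp,
    ha, ha]
end

section
variable {A : Type} [CStarAlgebra A] {n : ℕ}

theorem exists_eq_star_mul_self_of_spectrum_nonneg {a : A} (ha : IsSelfAdjoint a)
    (h : ∀ t : ℝ, (t : ℂ) ∈ spectrum ℂ a → 0 ≤ t) : ∃ b, a = star b * b := by
  let := CStarAlgebra.spectralOrder A
  have := CStarAlgebra.spectralOrderedRing A
  exact CStarAlgebra.nonneg_iff_eq_star_mul_self.1
    ((StarOrderedRing.nonneg_iff_spectrum_nonneg (R := ℝ) a ha).2 fun t ht =>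
      h t (spectrum.algebraMap_mem ℂ ht))

/-- Positivity of operators is preserved by representations of a closed `*`-subalgebra. -/
theorem re_inner_rep_subalgebra_nonneg {H : Type} {K : Type*}
    [NormedAddCommGroup H] [InnerProductSpace ℂ H] [CompleteSpace H] [NormedAddCommGroup K]
    [InnerProductSpace ℂ K] [CompleteSpace K]
    (D : StarSubalgebra ℂ (H →L[ℂ] H)) (hD : IsClosed (D : Set (H →L[ℂ] H)))
    (ρ : D →⋆ₐ[ℂ] (K →L[ℂ] K)) (E : D) (hE : ∀ v, 0 ≤ (⟪v, (E : H →L[ℂ] H) v⟫_ℂ).re) (w : K) :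
    0 ≤ (⟪w, ρ E w⟫_ℂ).re := by
  let := StarSubalgebra.cstarAlgebra D (h_closed := hD)
  have hsa : IsSelfAdjoint (E + star E) := IsSelfAdjoint.add_star_self E
  have hX : (0 : H →L[ℂ] H) ≤ ((E + star E : D) : H →L[ℂ] H) := by
    rw [ContinuousLinearMap.nonneg_iff_isPositive, ContinuousLinearMap.isPositive_def']
    refine ⟨hsa.map D.subtype, fun v => ?_⟩
    have h1 : ⟪(star (E : H →L[ℂ] H)) v, v⟫_ℂ = ⟪v, (E : H →L[ℂ] H) v⟫_ℂ := by
      rw [ContinuousLinearMap.star_eq_adjoint, ContinuousLinearMap.adjoint_inner_left]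
    have h2 := hE v
    have h3 : (⟪(E : H →L[ℂ] H) v, v⟫_ℂ).re = (⟪v, (E : H →L[ℂ] H) v⟫_ℂ).re := by
      rw [← inner_conj_symm, Complex.conj_re]
    simp only [ContinuousLinearMap.reApplyInnerSelf, StarMemClass.coe_star, AddMemClass.coe_add,
      add_apply, inner_add_left, h1, map_add, RCLike.re_to_complex, h3]
    linarith
  obtain ⟨c, hc⟩ := exists_eq_star_mul_self_of_spectrum_nonneg hsa fun t ht => by
    rw [StarSubalgebra.spectrum_eq (hS := hD)] at ht
    exact spectrum_nonneg_of_nonneg hX (spectrum.of_algebraMap_mem ℂ ht)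
  have h : 0 ≤ (⟪w, ρ (E + star E) w⟫_ℂ).re := by
    rw [hc, map_mul, mul_apply_eq_comp, ← inner_rep_left]
    exact inner_self_nonneg (𝕜 := ℂ)
  have h3 : (⟪w, ρ (star E) w⟫_ℂ).re = (⟪w, ρ E w⟫_ℂ).re := by
    rw [← inner_rep_left, ← inner_conj_symm, Complex.conj_re]
  rw [map_add, add_apply, inner_add_right, Complex.add_re, h3] at h
  linarith

/-- A closed inequality for tuples from a set extends to tuples from its closure. -/
theorem nonneg_of_mem_closure {K κ : Type*} [TopologicalSpace K] {R : Set K} {f : (κ → K) → ℝ}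
    (hf : Continuous f) (h : ∀ η, (∀ p, η p ∈ R) → 0 ≤ f η) (η : κ → K)
    (hη : ∀ p, η p ∈ closure R) : 0 ≤ f η := by
  have hη' : η ∈ closure (Set.univ.pi fun _ : κ => R) := by
    rw [closure_pi_set]
    exact fun p _ => hη p
  exact closure_minimal (s := Set.univ.pi fun _ => R) (t := {η | 0 ≤ f η})
    (fun η h' => h η fun p => h' p trivial) (isClosed_le continuous_const hf) hη'

/-- A closed subspace invariant under the generators of a closed `*`-subalgebra is invariant. -/
theorem mem_of_generators_mem {H K : Type} [NormedAddCommGroup H]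
    [InnerProductSpace ℂ H] [CompleteSpace H] [NormedAddCommGroup K] [InnerProductSpace ℂ K]
    [CompleteSpace K] {G : Set (H →L[ℂ] H)} (hG : ∀ x ∈ G, star x ∈ G)
    (D : StarSubalgebra ℂ (H →L[ℂ] H)) (hD : D = (StarAlgebra.adjoin ℂ G).topologicalClosure)
    (hGD : ∀ x ∈ G, x ∈ D)
    (ρ : D →⋆ₐ[ℂ] (K →L[ℂ] K)) (hρ : Continuous ρ)
    {V : Submodule ℂ K} (hVc : IsClosed (V : Set K))
    (hV : ∀ x (hx : x ∈ G), ∀ v ∈ V, ρ ⟨x, hGD x hx⟩ v ∈ V) (E : D) {v : K} (hv : v ∈ V) :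
    ρ E v ∈ V := by
  subst hD
  have key : ∀ x (hx : x ∈ StarAlgebra.adjoin ℂ G),
      (∀ v ∈ V, ρ ⟨x, StarSubalgebra.le_topologicalClosure _ hx⟩ v ∈ V) ∧
      (∀ v ∈ V, ρ ⟨star x, StarSubalgebra.le_topologicalClosure _ (star_mem hx)⟩ v ∈ V) := by
    intro x hx
    induction hx using StarAlgebra.adjoin_induction with
    | mem x hx => exact ⟨hV x hx, hV _ (hG x hx)⟩
    | algebraMap r =>
      constructor
      · intro v hv
        have : ρ (algebraMap ℂ _ r) v ∈ V := by
          rw [Algebra.algebraMap_eq_smul_one, map_smul, map_one]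
          exact V.smul_mem r hv
        exact this
      · intro v hv
        have : ρ (star (algebraMap ℂ _ r)) v ∈ V := by
          rw [Algebra.algebraMap_eq_smul_one, star_smul, star_one, map_smul, map_one]
          exact V.smul_mem _ hv
        exact this
    | add x y hx hy h1 h2 =>
      refine ⟨fun v hv => ?_, fun v hv => ?_⟩
      · have h := V.add_mem (h1.1 v hv) (h2.1 v hv)
        rwa [← add_apply, ← map_add] at h
      · have h := V.add_mem (h1.2 v hv) (h2.2 v hv)
        rw [← add_apply, ← map_add] at h
        simpa only [star_add] using! h
    | mul x y hx hy h1 h2 =>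
      refine ⟨fun v hv => ?_, fun v hv => ?_⟩
      · have h := h1.1 _ (h2.1 v hv)
        rwa [← mul_apply_eq_comp, ← map_mul] at h
      · have h := h2.2 _ (h1.2 v hv)
        rw [← mul_apply_eq_comp, ← map_mul] at h
        simpa only [star_mul] using! h
    | star x hx h => exact ⟨h.2, by simpa only [star_star] using h.1⟩
  have hd : DenseRange (Set.inclusion
      (StarSubalgebra.le_topologicalClosure (StarAlgebra.adjoin ℂ G))) := by
    exact (denseRange_inclusion_iff _).2 subset_rfl
  exact hd.induction_on (p := fun E => ρ E v ∈ V) E (hVc.preimage (by fun_prop))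
    fun x => (key x.1 x.2).1 v hv

variable {S : Type} [Fintype S] {H : Type} [NormedAddCommGroup H] [InnerProductSpace ℂ H]
  [CompleteSpace H]

/-- If `∑ s, φ (x s) ⊗ T s` is positive for all representations `φ` of dimension at most `n`, then
`∑ s, π (x s) * T s` is positive for every representation `π` commuting with the `T s`. -/
theorem re_sum_inner_nonneg_of_commuting (hA : IsSubhomogeneous n A)
    (π : A →⋆ₐ[ℂ] (H →L[ℂ] H)) (T : S → H →L[ℂ] H) (hT : ∀ s, IsSelfAdjoint (T s))
    (hcomm : ∀ s a, T s * π a = π a * T s) (x : S → A) (hpos : PositiveOnReps n x T) (ξ : H) :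
    0 ≤ (∑ s, ⟪ξ, π (x s) (T s ξ)⟫_ℂ).re := by
  let G : Set (H →L[ℂ] H) := Set.range π ∪ Set.range T
  have hG : ∀ x ∈ G, star x ∈ G := by
    rintro _ (⟨a, rfl⟩ | ⟨s, rfl⟩)
    · exact Or.inl ⟨star a, map_star π a⟩
    · exact Or.inr ⟨s, (hT s).star_eq.symm⟩
  obtain ⟨D, hDeq⟩ : ∃ D, D = (StarAlgebra.adjoin ℂ G).topologicalClosure := ⟨_, rfl⟩
  have hD : IsClosed (D : Set (H →L[ℂ] H)) := by
    rw [hDeq]; exact StarSubalgebra.isClosed_topologicalClosure _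
  have hGD : ∀ x ∈ G, x ∈ D := fun x hx => by
    rw [hDeq]
    exact StarSubalgebra.le_topologicalClosure _ (StarAlgebra.subset_adjoin ℂ G hx)
  let π' : A →⋆ₐ[ℂ] D := π.codRestrict D fun a => hGD _ (Or.inl ⟨a, rfl⟩)
  let T' : S → D := fun s => ⟨T s, hGD _ (Or.inr ⟨s, rfl⟩)⟩
  let := StarSubalgebra.cstarAlgebra D (h_closed := hD)
  let g : D →ₗ[ℂ] ℂ :=
    { toFun := fun E => ⟪ξ, (E : H →L[ℂ] H) ξ⟫_ℂ
      map_add' := fun E F => by simp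
      map_smul' := fun c E => by simp }
  by_contra! hneg
  obtain ⟨K, _, _, _, ρ, ζ, hρ, hζ, hlt⟩ := exists_irreducible_of_functional_neg g
    (fun E => by
      change 0 ≤ ⟪ξ, (star (E : H →L[ℂ] H)) ((E : H →L[ℂ] H) ξ)⟫_ℂ
      rw [ContinuousLinearMap.star_eq_adjoint, ContinuousLinearMap.adjoint_inner_right]
      rw [inner_self_eq_norm_sq_to_K]
      positivity)
    (∑ s, π' (x s) * T' s) (by
      rw [map_sum]
      exact hneg)
  refine hlt.not_ge ?_
  have hpos' : PositiveOnReps n x fun s => ρ (T' s) := by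
    intro H₁ _ _ _ _ φ hφ m b η
    refine nonneg_of_mem_closure (f := fun η : Fin m → K =>
        (∑ s, ∑ p, ∑ q, ⟪b p, φ (x s) (b q)⟫_ℂ * ⟪η p, ρ (T' s) (η q)⟫_ℂ).re)
      (by fun_prop) (fun η hη => ?_) η fun p => hζ (η p)
    choose d hd using hη
    have h := re_inner_rep_subalgebra_nonneg D hD ρ
      (∑ s, ∑ p, ∑ q, ⟪b p, φ (x s) (b q)⟫_ℂ • (star (d p) * (T' s * d q))) (fun v => by
        refine (hpos H₁ φ hφ m b fun p => (d p : H →L[ℂ] H) v).trans_eq (congrArg Complex.re ?_)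
        simp [T', ContinuousLinearMap.star_eq_adjoint,
          ContinuousLinearMap.adjoint_inner_right]) ζ
    refine h.trans_eq (congrArg Complex.re ?_)
    simp [← hd, inner_rep_left, mul_apply_eq_comp]
  have hirr : JointlyIrreducible (ρ.comp π') fun s => ρ (T' s) := by
    refine ⟨⟨ζ, ?_⟩, ?_, ?_⟩
    · rintro rfl
      simp at hlt
    · intro s a v
      have : T' s * π' a = π' a * T' s := Subtype.ext (hcomm s a)
      simp only [StarAlgHom.comp_apply, ← mul_apply_eq_comp, ← map_mul, this]
    · intro V hV hVπ hVT
      refine hρ.2 V hV fun E v hv =>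
        mem_of_generators_mem hG D hDeq hGD ρ
          (by open CStarAlgebra in exact map_continuous ρ) hV ?_ E hv
      rintro _ (⟨a, rfl⟩ | ⟨s, rfl⟩) v hv
      · exact hVπ a v hv
      · exact hVT s v hv
  have h := re_sum_inner_nonneg hA hirr x hpos' ζ
  simpa [mul_apply_eq_comp] using h
end

section
variable {A : Type} [CStarAlgebra A] {n : ℕ} {S : Type}

theorem starProjection_rep_comm {H : Type*} [NormedAddCommGroup H] [InnerProductSpace ℂ H]
    [CompleteSpace H] (π : A →⋆ₐ[ℂ] (H →L[ℂ] H)) {M : Submodule ℂ H} [M.HasOrthogonalProjection]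
    (hM : ∀ a : A, ∀ v ∈ M, π a v ∈ M) (a : A) (v : H) :
    M.starProjection (π a v) = π a (M.starProjection v) := by
  refine (Submodule.eq_starProjection_of_mem_orthogonal
    (hM a _ (Submodule.starProjection_apply_mem M v)) ?_)
  rw [← map_sub]
  exact rep_mem_orthogonal π hM a (Submodule.sub_starProjection_mem_orthogonal v)

/-- Tuples dominating the image of `x` under a map factoring through a finite-dimensional
`n`-subhomogeneous algebra. -/
def dominatingTuples (n : ℕ) (x : S → A) : Set (S → A) :=
  {w | ∃ T, FactorsThrough n T ∧ ∃ p : S → A, (∀ s, IsPosElem (p s)) ∧ ∀ s, w s = T (x s) + p s}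

theorem mem_closure_dominatingTuples [Fintype S] [DecidableEq S] (hA : IsSubhomogeneous n A)
    (x : S → A) (hx : ∀ s, IsSelfAdjoint (x s)) : x ∈ closure (dominatingTuples n x) := by
  by_contra hxW
  obtain ⟨g, hg, hgW, hgx⟩ := exists_positive_separating (dominatingTuples n x)
    (by
      rintro w ⟨T, hT, p, hp, hw⟩
      ext s
      obtain ⟨c, hc⟩ := hp s
      rw [Pi.star_apply, hw, hc, star_add, ← hT.apply_star, (hx s).star_eq, star_mul, star_star])
    (by
      rintro w ⟨T, hT, p, hp, hw⟩ w' ⟨T', hT', p', hp', hw'⟩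
      refine ⟨_, hT.add hT', p + p', fun s => ?_, fun s => ?_⟩
      · obtain ⟨c, hc⟩ := hp s
        obtain ⟨c', hc'⟩ := hp' s
        rw [Pi.add_apply, hc, hc']
        exact exists_star_mul_self_add c c'
      · simp only [Pi.add_apply, hw, hw']
        abel)
    (by
      rintro r hr w ⟨T, hT, p, hp, hw⟩
      refine ⟨_, hT.smul hr, r • p, fun s => ?_, fun s => ?_⟩
      · obtain ⟨c, hc⟩ := hp s
        refine ⟨√r • c, ?_⟩
        rw [Pi.smul_apply, hc, star_smul, star_trivial (√r), smul_mul_smul_comm,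
          Real.mul_self_sqrt hr]
      · simp only [Pi.smul_apply, hw, smul_add])
    (fun b => ⟨0, FactorsThrough.zero, star b * b, fun s => ⟨b s, rfl⟩, fun s => by simp⟩)
    x (by ext s; exact hx s) hxW
  obtain ⟨H, _, _, _, ρ, ξ, hgρ, -⟩ := exists_gns g hg
  let const : A →⋆ₐ[ℂ] (S → A) := { Pi.constAlgHom ℂ S A with map_star' := fun a => rfl }
  have hconst : ∀ a s, const a s = a := fun _ _ => rfl
  let π : A →⋆ₐ[ℂ] (H →L[ℂ] H) := ρ.comp const
  let P : S → H →L[ℂ] H := fun s => ρ (Pi.single s 1)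
  have hP : ∀ s, IsSelfAdjoint (P s) := fun s => by
    refine IsSelfAdjoint.map (f := ρ) (x := Pi.single s 1) ?_
    ext t
    rcases eq_or_ne t s with rfl | h
    · simp
    · simp [h]
  have hPπ : ∀ s a v, P s (π a v) = π a (P s v) := fun s a v => by
    have : (Pi.single s 1 : S → A) * const a = const a * Pi.single s 1 := by
      ext t
      rcases eq_or_ne t s with rfl | h
      · simp [hconst]
      · simp [hconst, h]
    have h := congrArg (fun w => ρ w v) this
    simp only [map_mul, mul_apply_eq_comp] at h
    exact h
  have hdecomp : ∀ w : S → A, ∀ v, ρ w v = ∑ s, π (w s) (P s v) := fun w v => by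
    have : w = ∑ s, const (w s) * Pi.single s 1 := by
      ext t
      rw [Finset.sum_apply, Finset.sum_eq_single t]
      · simp [hconst]
      · intro s _ hs
        simp [hs.symm]
      · simp
    conv_lhs => rw [this]
    simp only [map_sum, map_mul, sum_apply, mul_apply_eq_comp]
    rfl
  let R : Submodule ℂ H := LinearMap.range
    ({ toFun := fun a => π a ξ
       map_add' := fun a b => by simp
       map_smul' := fun c a => by simp } : A →ₗ[ℂ] H)
  let M := R.topologicalClosure
  have hMc : IsClosed (M : Set H) := R.isClosed_topologicalClosure
  have : CompleteSpace M := hMc.completeSpace_coe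
  have hMπ : ∀ a, ∀ v ∈ M, π a v ∈ M := fun a v hv => by
    refine closure_minimal (s := (R : Set H)) (t := π a ⁻¹' M) ?_ (hMc.preimage (by fun_prop)) hv
    rintro _ ⟨b, rfl⟩
    refine R.le_topologicalClosure ⟨a * b, ?_⟩
    simp [mul_apply_eq_comp]
  have hξM : ξ ∈ M := R.le_topologicalClosure ⟨1, by simp⟩
  let Q := M.starProjection
  have hQπ := starProjection_rep_comm π hMπ
  have hQξ : Q ξ = ξ := Submodule.starProjection_eq_self_iff.2 hξM
  have hpos : PositiveOnReps n x fun s => Q * P s * Q := by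
    intro H₁ _ _ _ _ φ hφ m b η
    have key := nonneg_of_mem_closure (R := (R : Set H)) (κ := Fin m)
      (f := fun η => (∑ s, ∑ p, ∑ q, ⟪b p, φ (x s) (b q)⟫_ℂ * ⟪η p, P s (η q)⟫_ℂ).re)
      (by fun_prop) (fun η hη => by
        choose a ha using hη
        have h := hgW _ ⟨_, factorsThrough_rowMap hφ φ b a, 0, fun s => ⟨0, by simp⟩,
          fun s => rfl⟩
        rw [hgρ, hdecomp] at h
        refine h.trans_eq (congrArg Complex.re ?_)
        rw [inner_sum]
        refine Finset.sum_congr rfl fun s _ => ?_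
        simp [rowMap_apply, inner_sum, inner_smul_right, ← ha, hPπ, mul_apply_eq_comp,
          inner_rep_left])
      (fun p => Q (η p)) (fun p => Submodule.starProjection_apply_mem M (η p))
    refine key.trans_eq (congrArg Complex.re ?_)
    simp only [mul_apply_eq_comp, Q, Submodule.inner_starProjection_left_eq_right]
  have h := re_sum_inner_nonneg_of_commuting hA π (fun s => Q * P s * Q)
    (fun s => by
      have := (hP s).conjugate Q
      rwa [(isSelfAdjoint_starProjection M).star_eq] at this)
    (fun s a => by
      ext v
      simp only [mul_apply_eq_comp, Q, hQπ, hPπ]) x hpos ξ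
  refine hgx.not_ge (h.trans_eq (congrArg Complex.re ?_))
  rw [hgρ, hdecomp, inner_sum]
  refine Finset.sum_congr rfl fun s _ => ?_
  rw [mul_apply_eq_comp, mul_apply_eq_comp, hQξ, ← hQπ,
    ← Submodule.inner_starProjection_left_eq_right]
  exact congrArg (fun u => ⟪u, _⟫_ℂ) hQξ
end

section
variable {A : Type} [CStarAlgebra A] {n : ℕ} {S : Type}

theorem norm_star_mul_self_le_add (b c : A) : ‖star b * b‖ ≤ ‖star b * b + star c * c‖ := by
  let := CStarAlgebra.spectralOrder A
  have := CStarAlgebra.spectralOrderedRing A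
  exact CStarAlgebra.norm_le_norm_of_nonneg_of_le (star_mul_self_nonneg b)
    (le_add_of_nonneg_right (star_mul_self_nonneg c))

theorem exists_star_mul_self_eq_of_norm_le {a : A} (ha : IsSelfAdjoint a) {r : ℝ}
    (h : ‖a‖ ≤ r) : ∃ b, (r : ℂ) • (1 : A) - a = star b * b := by
  let := CStarAlgebra.spectralOrder A
  have := CStarAlgebra.spectralOrderedRing A
  refine CStarAlgebra.nonneg_iff_eq_star_mul_self.1 (sub_nonneg.2 ?_)
  refine ha.le_algebraMap_norm_self.trans ?_
  have := algebraMap_mono A h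
  simpa [Algebra.algebraMap_eq_smul_one] using this

theorem FactorsThrough.exists_linearMap {T : A → A} (hT : FactorsThrough n T) :
    ∃ L : A →ₗ[ℂ] A, ⇑L = T := by
  obtain ⟨F, _, φ, ψ, -, -, -, -, h⟩ := hT
  exact ⟨ψ ∘ₗ φ.toAlgHom.toLinearMap, funext fun x => (h x).symm⟩

theorem exists_factorsThrough_isSelfAdjoint [Finite S] (hA : IsSubhomogeneous n A) (y : S → A)
    (hy : ∀ s, IsSelfAdjoint (y s)) {ε : ℝ} (hε : 0 < ε) :
    ∃ T, FactorsThrough n T ∧ ∀ s, ‖y s - T (y s)‖ < ε := by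
  classical
  have := Fintype.ofFinite S
  obtain ⟨w, ⟨T, hT, p, hp, hw⟩, hdist⟩ := Metric.mem_closure_iff.1
    (mem_closure_dominatingTuples hA (Sum.elim y (-y)) (by
      rintro (s | s)
      · exact hy s
      · exact (hy s).neg)) (ε / 3) (by positivity)
  refine ⟨T, hT, fun s => ?_⟩
  obtain ⟨L, rfl⟩ := hT.exists_linearMap
  have h1 := (dist_pi_lt_iff (by positivity)).1 hdist (Sum.inl s)
  have h2 := (dist_pi_lt_iff (by positivity)).1 hdist (Sum.inr s)
  obtain ⟨b, hb⟩ := hp (Sum.inl s)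
  obtain ⟨c, hc⟩ := hp (Sum.inr s)
  have h3 := norm_star_mul_self_le_add b c
  simp only [dist_eq_norm, hw, Sum.elim_inl, Sum.elim_inr, Pi.neg_apply, map_neg, hb, hc] at h1 h2
  have e1 : y s - L (y s) = (y s - (L (y s) + star b * b)) + star b * b := by abel
  have e2 : star b * b + star c * c =
      -((y s - (L (y s) + star b * b)) + (- y s - (-L (y s) + star c * c))) := by abel
  rw [e2, norm_neg] at h3
  have h4 := norm_add_le (y s - (L (y s) + star b * b)) (- y s - (-L (y s) + star c * c))
  rw [e1]
  have h5 := norm_add_le (y s - (L (y s) + star b * b)) (star b * b)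
  linarith

theorem exists_factorsThrough [Finite S] (hA : IsSubhomogeneous n A) (x : S → A) {ε : ℝ}
    (hε : 0 < ε) : ∃ T, FactorsThrough n T ∧ ∀ s, ‖x s - T (x s)‖ < ε := by
  obtain ⟨T, hT, h⟩ := exists_factorsThrough_isSelfAdjoint hA
    (Sum.elim (fun s => (realPart (x s) : A)) fun s => (imaginaryPart (x s) : A)) (by
      rintro (s | s)
      · exact (realPart (x s)).2
      · exact (imaginaryPart (x s)).2) (half_pos hε)
  refine ⟨T, hT, fun s => ?_⟩
  obtain ⟨L, rfl⟩ := hT.exists_linearMap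
  have h1 := h (Sum.inl s)
  have h2 := h (Sum.inr s)
  simp only [Sum.elim_inl, Sum.elim_inr] at h1 h2
  have e : x s - L (x s) = ((realPart (x s) : A) - L (realPart (x s) : A)) +
      Complex.I • ((imaginaryPart (x s) : A) - L (imaginaryPart (x s) : A)) := by
    conv_lhs => rw [← realPart_add_I_smul_imaginaryPart (x s)]
    rw [map_add, map_smul, smul_sub]
    abel
  rw [e]
  refine (norm_add_le _ _).trans_lt ?_
  rw [norm_smul, Complex.norm_I, one_mul]
  linarith

theorem exists_factorsThrough_smul [Nontrivial A] (hA : IsSubhomogeneous n A) (c : A) :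
    ∃ ω : A → ℂ, ω 1 = 1 ∧ (∀ x, ‖ω x‖ ≤ ‖x‖) ∧
      FactorsThrough n fun x => ω x • (star c * c) := by
  obtain ⟨H, _, _, _, φ, hirr, h1⟩ := exists_irreducible_ne_zero (1 : A) one_ne_zero
  have hrank := hA H (φ : A →⋆ₙₐ[ℂ] (H →L[ℂ] H)) hirr
  have : FiniteDimensional ℂ H :=
    Module.rank_lt_aleph0_iff.1 (hrank.trans_lt (Cardinal.natCast_lt_aleph0))
  have hfin : Module.finrank ℂ H ≤ n := Module.finrank_le_of_rank_le hrank
  have : Nontrivial H := by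
    by_contra hn
    rw [not_nontrivial_iff_subsingleton] at hn
    exact h1 (Subsingleton.elim _ _)
  let b := stdOrthonormalBasis ℂ H
  let i : Fin (Module.finrank ℂ H) := ⟨0, Module.finrank_pos⟩
  have hb : ‖b i‖ = 1 := b.norm_eq_one i
  refine ⟨fun x => ⟪b i, φ x (b i)⟫_ℂ, ?_, fun x => ?_, ?_⟩
  · simp only
    rw [map_one, one_apply_eq_self, inner_self_eq_norm_sq_to_K, hb]
    simp
  · simpa [hb] using norm_inner_rep_le φ x (b i)
  · convert factorsThrough_rowMap hfin φ b (Pi.single i c) using 2 with x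
    rw [rowMap_apply, Finset.sum_eq_single i, Finset.sum_eq_single i]
    · simp
    · intro q _ hq
      simp [hq]
    · simp
    · intro q _ hq
      simp [hq]
    · simp

/-- A subhomogeneous algebra admits approximate u.c.p. factorizations on finite sets. -/
theorem exists_unital_factorsThrough (hA : IsSubhomogeneous n A) (s : Finset A) {ε : ℝ}
    (hε : 0 < ε) : ∃ T, FactorsThrough n T ∧ T 1 = 1 ∧
      ∀ x ∈ s, ‖x - T x‖ ≤ ε * (1 + 3 * ‖x‖) := by
  rcases subsingleton_or_nontrivial A with _ | _
  · exact ⟨0, FactorsThrough.zero, Subsingleton.elim _ _, fun x _ => by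
      rw [Subsingleton.elim (x - _) 0, norm_zero]; positivity⟩
  obtain ⟨T, hT, h⟩ := exists_factorsThrough hA (fun o : Option s => o.elim 1 Subtype.val) hε
  have h1 : ‖1 - T 1‖ < ε := h none
  obtain ⟨c, hc⟩ := exists_star_mul_self_eq_of_norm_le (a := T 1 - 1) (r := ε)
    (by rw [IsSelfAdjoint, star_sub, ← hT.apply_star, star_one]) (by rw [norm_sub_rev]; exact h1.le)
  obtain ⟨ω, hω1, hω, hω'⟩ := exists_factorsThrough_smul hA c
  have hc' : ‖star c * c‖ ≤ 2 * ε := by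
    rw [← hc]
    refine (norm_sub_le _ _).trans ?_
    rw [norm_smul, norm_one, norm_sub_rev (T 1), Complex.norm_real, Real.norm_of_nonneg hε.le]
    linarith
  have hne : (1 + ε) ≠ 0 := by positivity
  refine ⟨_, (hT.add hω').smul (r := (1 + ε)⁻¹) (by positivity), ?_, fun x hx => ?_⟩
  · rw [Pi.smul_apply, Pi.add_apply, hω1, one_smul, ← hc, inv_smul_eq_iff₀ hne, add_smul, one_smul,
      Complex.coe_smul]
    abel
  · have hx' : ‖x - T x‖ < ε := h (some ⟨x, hx⟩)
    have e : x - ((1 + ε)⁻¹ • (T + fun x => ω x • (star c * c))) x =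
        (1 + ε)⁻¹ • ((x - T x) + ε • x - ω x • (star c * c)) := by
      rw [eq_inv_smul_iff₀ hne, smul_sub, Pi.smul_apply, smul_inv_smul₀ hne, add_smul, one_smul,
        Pi.add_apply]
      abel
    have hbound : ‖(x - T x) + ε • x - ω x • (star c * c)‖ ≤ ε * (1 + 3 * ‖x‖) := by
      refine (norm_sub_le _ _).trans ((add_le_add_left (norm_add_le _ _) _).trans ?_)
      rw [norm_smul, norm_smul, Real.norm_of_nonneg hε.le]
      have := mul_le_mul (hω x) hc' (norm_nonneg _) (norm_nonneg _)
      linarith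
    rw [e, norm_smul, Real.norm_of_nonneg (by positivity)]
    refine (mul_le_of_le_one_left (norm_nonneg _) (inv_le_one_of_one_le₀ (by linarith))).trans
      hbound
end

end

/-- Every unital `n`-subhomogeneous C*-algebra `A` admits nets of
finite-dimensional `n`-subhomogeneous C*-algebras `F_α`, unital `*`-homomorphisms
`φ_α : A → F_α` and u.c.p. maps `ψ_α : F_α → A` with `‖x − ψ_α (φ_α x)‖ → 0` for all
`x ∈ A`. -/
theorem stmt13 (n : ℕ) (hn : 1 ≤ n) (A : Type) [CStarAlgebra A]
    (hA : IsSubhomogeneous n A) : Nonempty (SubhomApproxNet n A) := by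
  classical
  have h (i : Finset A × ℕ) := exists_unital_factorsThrough hA i.1
    (ε := 1 / ((i.2 : ℝ) + 1)) (by positivity)
  choose T hT hT1 hTx using h
  choose F inst φ ψ hF hsub hcp hstar hψ using hT
  exact ⟨
    { ι := Finset A × ℕ
      directed := fun a b => exists_ge_ge a b
      F := F
      instF := inst
      findim := hF
      subhom := hsub
      φ := φ
      ψ := ψ
      ψ_unital := fun i => by rw [← map_one (φ i), ← hψ, hT1]
      ψ_cp := hcp
      approx := fun x => by
        have hlim : Tendsto (fun i : Finset A × ℕ => 1 / ((i.2 : ℝ) + 1) * (1 + 3 * ‖x‖)) atTop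
            (𝓝 0) := by
          rw [← prod_atTop_atTop_eq]
          simpa using (tendsto_one_div_add_atTop_nhds_zero_nat.comp tendsto_snd).mul_const
            (1 + 3 * ‖x‖)
        refine squeeze_zero' (Eventually.of_forall fun i => norm_nonneg _) ?_ hlim
        filter_upwards [eventually_ge_atTop (({x}, 0) : Finset A × ℕ)] with i hi
        rw [← hψ]
        exact hTx i x (hi.1 (Finset.mem_singleton_self x)) }⟩

end
end

section
/- Let A be a C*-algebra. If there exist nets of completely contractive completely positive maps φ_α : A → F_α and ψ_α : F_α → A with each F_α a finite-dimensional n-subhomogeneous C*-algebra, such that ‖x − ψ_α(φ_α(x))‖ → 0 for all x ∈ A, then A is n-subhomogeneous. -/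
noncomputable section

open Filter Topology

/-- A net (indexed by a nonempty directed preorder) of finite-dimensional
`n`-subhomogeneous C*-algebras `F i` and completely contractive completely positive maps
`φ i : A → F i`, `ψ i : F i → A` such that `‖x - ψ i (φ i x)‖ → 0` for every `x ∈ A`.
(A contractive completely positive map is automatically completely contractive.) -/
structure CcpApproxNet (n : ℕ) (A : Type) [NonUnitalCStarAlgebra A] where
  ι : Type
  [pre : Preorder ι]
  [ne : Nonempty ι]
  directed : ∀ a b : ι, ∃ c, a ≤ c ∧ b ≤ c
  F : ι → Type
  [instF : ∀ i, CStarAlgebra (F i)]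
  findim : ∀ i, FiniteDimensional ℂ (F i)
  subhom : ∀ i, IsSubhomogeneous n (F i)
  φ : ∀ i, A →ₗ[ℂ] F i
  φ_contr : ∀ i, ∀ x, ‖φ i x‖ ≤ ‖x‖
  φ_cp : ∀ i, CompletelyPositive (φ i)
  ψ : ∀ i, F i →ₗ[ℂ] A
  ψ_contr : ∀ i, ∀ y, ‖ψ i y‖ ≤ ‖y‖
  ψ_cp : ∀ i, CompletelyPositive (ψ i)
  approx : ∀ x : A, Filter.Tendsto (fun i => ‖x - ψ i (φ i x)‖) Filter.atTop (𝓝 0)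

section Density

variable {A H : Type*} [NonUnitalCStarAlgebra A] [NormedAddCommGroup H] [InnerProductSpace ℂ H]
  [CompleteSpace H] {π : A →⋆ₙₐ[ℂ] (H →L[ℂ] H)}

/-- In an irreducible representation, the kernel of a bounded operator commuting with the image is
trivial. -/
lemma IsIrreducibleRep.ker_eq_bot_or_eq_zero (hπ : IsIrreducibleRep π) {T : H →L[ℂ] H}
    (hT : ∀ a, Commute (π a) T) : LinearMap.ker T.toLinearMap = ⊥ ∨ T = 0 := by
  refine (hπ.2 (LinearMap.ker T.toLinearMap) T.isClosed_ker fun a v hv => ?_).imp_right fun h => ?_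
  · simp only [LinearMap.mem_ker, ContinuousLinearMap.coe_coe] at hv ⊢
    have := congrArg (fun S : H →L[ℂ] H => S v) (hT a).eq
    simpa [hv] using this.symm
  · ext v
    have : v ∈ LinearMap.ker T.toLinearMap := h ▸ Submodule.mem_top
    simpa using this

lemma IsIrreducibleRep.nontrivial (hπ : IsIrreducibleRep π) : Nontrivial H := by
  obtain ⟨a, ha⟩ := hπ.1
  by_contra h
  rw [not_nontrivial_iff_subsingleton] at h
  exact ha (Subsingleton.elim _ _)

/-- Schur's lemma for self-adjoint operators. -/
lemma IsIrreducibleRep.exists_eq_algebraMap_of_isSelfAdjoint (hπ : IsIrreducibleRep π)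
    {T : H →L[ℂ] H} (hTs : IsSelfAdjoint T) (hT : ∀ a, Commute (π a) T) :
    ∃ c : ℂ, T = algebraMap ℂ (H →L[ℂ] H) c := by
  have := hπ.nontrivial
  obtain ⟨s, hs⟩ := ContinuousFunctionalCalculus.spectrum_nonempty (R := ℝ) T hTs
  have key : ∀ t ∈ spectrum ℝ T, t = s := by
    intro t ht
    by_contra hts
    set δ : ℝ := |t - s| / 2 with hδ
    have hδ0 : 0 < δ := by have := abs_pos.2 (sub_ne_zero.2 hts); positivity
    let bump : ℝ → ℝ → ℝ := fun p x => max 0 (δ - |x - p|)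
    have hcont : ∀ p, Continuous (bump p) := fun p => by fun_prop
    have hne : ∀ p ∈ spectrum ℝ T, cfc (bump p) T ≠ 0 := by
      intro p hp h0
      have h1 : bump p p ∈ spectrum ℝ (cfc (bump p) T) := by
        rw [cfc_map_spectrum (bump p) T hTs (hcont p).continuousOn]
        exact ⟨p, hp, rfl⟩
      rw [h0, spectrum.zero_eq] at h1
      have : bump p p = δ := by simp [bump, hδ0.le]
      rw [this] at h1
      exact hδ0.ne' h1
    have hprod : cfc (bump s) T * cfc (bump t) T = 0 := by
      rw [← cfc_mul (bump s) (bump t) T (hcont s).continuousOn (hcont t).continuousOn]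
      convert cfc_zero ℝ T using 2
      ext x
      simp only [Pi.zero_apply, mul_eq_zero, bump, max_eq_left_iff, sub_nonpos]
      by_contra! h
      have := abs_sub_le t x s
      rw [abs_sub_comm t x] at this
      linarith
    rcases hπ.ker_eq_bot_or_eq_zero (fun a => ((hT a).symm.cfc_real (bump s)).symm) with h | h
    · apply hne t ht
      ext v
      have : cfc (bump t) T v ∈ LinearMap.ker (cfc (bump s) T).toLinearMap := by
        have := congrArg (fun S : H →L[ℂ] H => S v) hprod
        simpa using this
      rw [h] at this
      simpa using this
    · exact hne s hs h
  refine ⟨(s : ℂ), ?_⟩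
  conv_lhs => rw [← cfc_id ℝ T hTs]
  rw [cfc_congr (f := id) (g := fun _ => s) (fun t ht => key t ht), cfc_const s T hTs]
  ext v
  simp [Algebra.algebraMap_eq_smul_one]

open scoped ComplexStarModule in
/-- **Schur's lemma** for irreducible representations on Hilbert spaces. -/
lemma IsIrreducibleRep.exists_eq_algebraMap (hπ : IsIrreducibleRep π)
    {T : H →L[ℂ] H} (hT : ∀ a, Commute (π a) T) :
    ∃ c : ℂ, T = algebraMap ℂ (H →L[ℂ] H) c := by
  have hT' : ∀ a, Commute (π a) (star T) := fun a => by
    have := (hT (star a)).star_star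
    rwa [map_star, star_star] at this
  obtain ⟨c, hc⟩ := hπ.exists_eq_algebraMap_of_isSelfAdjoint (realPart T).2 fun a => by
    rw [realPart_apply_coe]
    exact ((hT a).add_right (hT' a)).smul_right _
  obtain ⟨d, hd⟩ := hπ.exists_eq_algebraMap_of_isSelfAdjoint (imaginaryPart T).2 fun a => by
    rw [imaginaryPart_apply_coe]
    exact (((hT a).sub_right (hT' a)).smul_right _).smul_right _
  refine ⟨c + Complex.I * d, ?_⟩
  rw [← realPart_add_I_smul_imaginaryPart T, hc, hd, map_add, map_mul]
  simp [Algebra.algebraMap_eq_smul_one, smul_smul, mul_comm]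

/-- A vector killed by an irreducible representation vanishes. -/
lemma IsIrreducibleRep.eq_zero_of_forall_apply_eq_zero (hπ : IsIrreducibleRep π) {v : H}
    (hv : ∀ a, π a v = 0) : v = 0 := by
  let S : Submodule ℂ H := ⨅ a, LinearMap.ker (π a).toLinearMap
  have hS : ∀ w, w ∈ S ↔ ∀ a, π a w = 0 := fun w => by simp [S]
  rcases hπ.2 S (by
      simp only [S, Submodule.coe_iInf]
      exact isClosed_iInter fun a => (π a).isClosed_ker)
    (fun a w hw => by simp [(hS w).1 hw a]) with h | h
  · have : v ∈ S := (hS v).2 hv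
    simpa [h] using this
  · obtain ⟨a, ha⟩ := hπ.1
    refine absurd ?_ ha
    ext w
    exact (hS w).1 (h ▸ Submodule.mem_top) a

/-- A Hilbert space version of the **Jacobson density theorem**: an irreducible representation
moves a finite linearly independent family approximately to any other family. -/
lemma IsIrreducibleRep.dense_range_apply (hπ : IsIrreducibleRep π) {ι : Type*} [Fintype ι]
    {v : ι → H} (hv : LinearIndependent ℂ v) : DenseRange fun a k => π a (v k) := by
  classical
  let e := PiLp.continuousLinearEquiv 2 ℂ (fun _ : ι => H)
  let R : A →ₗ[ℂ] PiLp 2 (fun _ : ι => H) :=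
    { toFun := fun a => WithLp.toLp 2 fun k => π a (v k)
      map_add' := fun a b => by ext; simp
      map_smul' := fun c a => by ext; simp }
  let M : Submodule ℂ (PiLp 2 fun _ : ι => H) := (LinearMap.range R).topologicalClosure
  let D : A → (PiLp 2 (fun _ : ι => H) →L[ℂ] PiLp 2 (fun _ : ι => H)) := fun a =>
    e.symm.toContinuousLinearMap ∘L
      (ContinuousLinearMap.pi fun k => π a ∘L ContinuousLinearMap.proj k) ∘L e.toContinuousLinearMap
  have hDa : ∀ a w k, D a w k = π a (w k) := fun a w k => rfl
  have hDM : ∀ a, ∀ w ∈ M, D a w ∈ M := by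
    intro a w hw
    refine map_mem_closure (D a).continuous hw ?_
    rintro _ ⟨b, rfl⟩
    exact ⟨a * b, by ext k; simp [R, hDa]⟩
  have hDadj : ∀ a x y, inner ℂ (D a x) y = inner ℂ x (D (star a) y) := by
    intro a x y
    simp only [PiLp.inner_apply, hDa, map_star, ContinuousLinearMap.star_eq_adjoint,
      ContinuousLinearMap.adjoint_inner_right]
  have hDMo : ∀ a, ∀ w ∈ Mᗮ, D a w ∈ Mᗮ := by
    intro a w hw u hu
    have := hw _ (hDM (star a) u hu)
    rwa [hDadj, star_star] at this
  have : CompleteSpace M := (Submodule.isClosed_topologicalClosure _).completeSpace_coe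
  let P := M.starProjection
  have hPD : ∀ a w, P (D a w) = D a (P w) := by
    intro a w
    refine (Submodule.eq_starProjection_of_mem_of_inner_eq_zero
      (hDM a _ (M.starProjection_apply_mem w)) fun u hu => ?_)
    rw [← map_sub, hDadj]
    exact M.starProjection_inner_eq_zero w _ (hDM _ u hu)
  let E : ι → H →L[ℂ] PiLp 2 (fun _ : ι => H) := fun j =>
    e.symm.toContinuousLinearMap ∘L ContinuousLinearMap.single ℂ (fun _ => H) j
  have hE : ∀ w : PiLp 2 (fun _ : ι => H), w = ∑ j, E j (w j) := by
    intro w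
    ext k
    simp [E, e, Finset.sum_pi_single]
  have hscal : ∀ i j, ∃ c : ℂ, ∀ x, P (E j x) i = c • x := by
    intro i j
    let T : H →L[ℂ] H := ContinuousLinearMap.proj (R := ℂ) (φ := fun _ : ι => H) i ∘L
      e.toContinuousLinearMap ∘L P ∘L E j
    obtain ⟨c, hc⟩ := hπ.exists_eq_algebraMap (T := T) fun a => by
      ext x
      have h1 : D a (E j x) = E j (π a x) := by
        ext k
        rw [hDa]
        by_cases hk : k = j
        · subst hk; simp [E, e]
        · simp [E, e, hk]
      change π a (P (E j x) i) = P (E j (π a x)) i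
      rw [← h1, hPD, hDa]
    refine ⟨c, fun x => ?_⟩
    have := congrArg (fun S : H →L[ℂ] H => S x) hc
    simp only [Algebra.algebraMap_eq_smul_one] at this
    exact this
  choose c hc using hscal
  have hPw : ∀ w i, P w i = ∑ j, c i j • w j := by
    intro w i
    conv_lhs => rw [hE w, map_sum]
    simp [hc]
  have hPv : P (WithLp.toLp 2 v) = WithLp.toLp 2 v := by
    ext i
    rw [← sub_eq_zero]
    refine hπ.eq_zero_of_forall_apply_eq_zero fun a => ?_
    rw [map_sub, ← hDa, ← hPD]
    have h1 : D a (WithLp.toLp 2 v) ∈ M := subset_closure ⟨a, rfl⟩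
    rw [Submodule.starProjection_eq_self_iff.2 h1, hDa, sub_self]
  have hc1 : ∀ i j, c i j = if i = j then 1 else 0 := by
    intro i
    have h1 : ∑ j, (c i j - if i = j then 1 else 0) • v j = 0 := by
      simp only [sub_smul, Finset.sum_sub_distrib, ite_smul, one_smul, zero_smul,
        Finset.sum_ite_eq, Finset.mem_univ, if_true]
      rw [sub_eq_zero, ← hPw (WithLp.toLp 2 v) i, hPv]
    exact fun j => sub_eq_zero.1 (Fintype.linearIndependent_iff.1 hv _ h1 j)
  have hMtop : ∀ w, w ∈ M := by
    intro w
    have : P w = w := by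
      ext i
      simp [hPw, hc1]
    exact this ▸ M.starProjection_apply_mem w
  have hR : DenseRange R := fun w => hMtop w
  exact e.surjective.denseRange.comp hR e.continuous

end Density

section FiniteDimensional

/-- If a matrix with entries `z j (v k)` is formed from vectors `v k` in a space of dimension at
most `n`, then the norm of its trace is at most `√n` times its Hilbert-Schmidt norm. -/
lemma norm_sq_sum_apply_le_of_finrank_le {L L' : Type*} [NormedAddCommGroup L]
    [InnerProductSpace ℂ L] [FiniteDimensional ℂ L] [NormedAddCommGroup L'] [NormedSpace ℂ L']
    {n : ℕ} (hn : Module.finrank ℂ L ≤ n)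
    {ι : Type*} [Fintype ι] (v : ι → L) (z : ι → L →ₗ[ℂ] L') :
    ‖∑ j, z j (v j)‖ ^ 2 ≤ n * ∑ j, ∑ k, ‖z j (v k)‖ ^ 2 := by
  classical
  let V : EuclideanSpace ℂ ι →ₗ[ℂ] L :=
    Fintype.linearCombination ℂ v ∘ₗ (WithLp.linearEquiv 2 ℂ (ι → ℂ)).toLinearMap
  have hV : ∀ x, V x = ∑ k, x k • v k := fun x => rfl
  let W := (LinearMap.ker V)ᗮ
  let e : ι → EuclideanSpace ℂ ι := fun j => EuclideanSpace.single j 1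
  have hVQ : ∀ j, V (W.starProjection (e j)) = v j := by
    intro j
    have h1 : e j - W.starProjection (e j) ∈ LinearMap.ker V := by
      have := W.sub_starProjection_mem_orthogonal (e j)
      rwa [Submodule.orthogonal_orthogonal] at this
    rw [LinearMap.mem_ker, map_sub, sub_eq_zero] at h1
    rw [← h1, hV]
    simp [e]
  have hW : Module.finrank ℂ W ≤ n := by
    have h1 := (LinearMap.ker V).finrank_add_finrank_orthogonal
    have h2 := V.finrank_range_add_finrank_ker
    have h3 := (LinearMap.range V).finrank_le
    change _ + Module.finrank ℂ W = _ at h1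
    omega
  have hQ : ∑ j, ∑ k, ‖W.starProjection (e j) k‖ ^ 2 = Module.finrank ℂ W := by
    let b := stdOrthonormalBasis ℂ W
    have h1 : ∀ j, ∑ k, ‖W.starProjection (e j) k‖ ^ 2 =
        ∑ s, ‖(b s : EuclideanSpace ℂ ι) j‖ ^ 2 := by
      intro j
      rw [← EuclideanSpace.norm_sq_eq, Submodule.starProjection_apply, ← Submodule.coe_norm,
        ← b.sum_sq_norm_inner_right]
      refine Finset.sum_congr rfl fun s _ => ?_
      rw [Submodule.inner_orthogonalProjectionOnto_eq_of_mem_left]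
      simp [e, EuclideanSpace.inner_single_right]
    simp_rw [h1]
    rw [Finset.sum_comm]
    simp_rw [← EuclideanSpace.norm_sq_eq, ← Submodule.coe_norm, b.norm_eq_one]
    simp
  have hle : ‖∑ j, z j (v j)‖ ≤
      ∑ p : ι × ι, ‖W.starProjection (e p.1) p.2‖ * ‖z p.1 (v p.2)‖ := by
    rw [Fintype.sum_prod_type]
    refine (norm_sum_le _ _).trans (Finset.sum_le_sum fun j _ => ?_)
    conv_lhs => rw [← hVQ j, hV, map_sum]
    refine (norm_sum_le _ _).trans (Finset.sum_le_sum fun k _ => ?_)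
    rw [map_smul, norm_smul]
  calc ‖∑ j, z j (v j)‖ ^ 2
      ≤ (∑ p : ι × ι, ‖W.starProjection (e p.1) p.2‖ * ‖z p.1 (v p.2)‖) ^ 2 := by gcongr
    _ ≤ (∑ p : ι × ι, ‖W.starProjection (e p.1) p.2‖ ^ 2) *
          ∑ p : ι × ι, ‖z p.1 (v p.2)‖ ^ 2 := Finset.sum_mul_sq_le_sq_mul_sq _ _ _
    _ = Module.finrank ℂ W * ∑ j, ∑ k, ‖z j (v k)‖ ^ 2 := by
        rw [Fintype.sum_prod_type, Fintype.sum_prod_type, hQ]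
    _ ≤ n * ∑ j, ∑ k, ‖z j (v k)‖ ^ 2 := by gcongr

variable {F L : Type} [NonUnitalCStarAlgebra F] [NormedAddCommGroup L] [InnerProductSpace ℂ L]
  [FiniteDimensional ℂ L]

/-- The restriction of a representation to an invariant subspace. -/
def restrictRep [CompleteSpace L] (ρ : F →⋆ₙₐ[ℂ] (L →L[ℂ] L)) (S : Submodule ℂ L) [CompleteSpace S]
    (hS : ∀ a, ∀ v ∈ S, ρ a v ∈ S) : F →⋆ₙₐ[ℂ] (S →L[ℂ] S) where
  toFun a := (ρ a).restrict (p := S) (q := S) (hS a)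
  map_smul' c a := by ext; simp
  map_zero' := by ext; simp
  map_add' a b := by ext; simp
  map_mul' a b := by ext; simp
  map_star' a := by
    rw [ContinuousLinearMap.star_eq_adjoint, ContinuousLinearMap.eq_adjoint_iff]
    intro x y
    simp [Submodule.coe_inner, map_star, ContinuousLinearMap.star_eq_adjoint,
      ContinuousLinearMap.adjoint_inner_left]

lemma IsSubhomogeneous.norm_sq_sum_apply_le_of_mem [CompleteSpace L] {n : ℕ}
    (hF : IsSubhomogeneous n F)
    (ρ : F →⋆ₙₐ[ℂ] (L →L[ℂ] L)) {ι : Type*} [Fintype ι] (z : ι → F) (S : Submodule ℂ L)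
    (hS : ∀ a, ∀ v ∈ S, ρ a v ∈ S) (v : ι → L) (hv : ∀ k, v k ∈ S) :
    ‖∑ j, ρ (z j) (v j)‖ ^ 2 ≤ n * ∑ j, ∑ k, ‖ρ (z j) (v k)‖ ^ 2 := by
  induction hd : Module.finrank ℂ S using Nat.strong_induction_on generalizing S v with
  | _ d ih =>
  subst hd
  by_cases hzero : ∀ a, ∀ w ∈ S, ρ a w = 0
  · rw [Finset.sum_eq_zero fun j _ => hzero _ _ (hv j), norm_zero, zero_pow two_ne_zero]
    positivity
  by_cases hirr : ∀ T ≤ S, (∀ a, ∀ v ∈ T, ρ a v ∈ T) → T = ⊥ ∨ T = S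
  · have hρS : IsIrreducibleRep (restrictRep ρ S hS) := by
      constructor
      · push Not at hzero
        obtain ⟨a, w, hw, haw⟩ := hzero
        refine ⟨a, fun h => haw ?_⟩
        have := congrArg (fun B : S →L[ℂ] S => ((B ⟨w, hw⟩ : S) : L)) h
        exact this
      · intro T _ hT
        rcases hirr (T.map S.subtype) (Submodule.map_subtype_le S T) (by
          rintro a _ ⟨w, hw, rfl⟩
          exact ⟨_, hT a w hw, rfl⟩) with h | h
        · exact Or.inl (Submodule.map_injective_of_injective S.injective_subtype (h.trans (Submodule.map_bot _).symm))
        · refine Or.inr (eq_top_iff.2 fun w _ => ?_)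
          have : (w : L) ∈ T.map S.subtype := by rw [h]; exact w.2
          obtain ⟨w', hw', h'⟩ := this
          rwa [← Subtype.ext h']
    have hdim : Module.finrank ℂ S ≤ n := by
      have := hF S (restrictRep ρ S hS) hρS
      rw [← Module.finrank_eq_rank] at this
      exact_mod_cast this
    exact norm_sq_sum_apply_le_of_finrank_le hdim (fun k => (⟨v k, hv k⟩ : S))
      (fun j => (ρ (z j)).toLinearMap ∘ₗ S.subtype)
  · push Not at hirr
    obtain ⟨T, hTS, hT, hTbot, hTne⟩ := hirr
    have hTo : ∀ a, ∀ v ∈ Tᗮ, ρ a v ∈ Tᗮ := by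
      intro a w hw u hu
      have := hw _ (hT (star a) u hu)
      rwa [map_star, ContinuousLinearMap.star_eq_adjoint,
        ContinuousLinearMap.adjoint_inner_left] at this
    have hlt : T < S := lt_of_le_of_ne hTS hTne
    have hlt' : Tᗮ ⊓ S < S := by
      refine lt_of_le_of_ne inf_le_right fun h => hTbot ?_
      have h1 : T ≤ Tᗮ := hTS.trans (inf_eq_right.1 h)
      exact (Submodule.eq_bot_iff _).2 fun x hx =>
        inner_self_eq_zero.1 (h1 hx x hx)
    let p : ι → L := fun k => T.starProjection (v k)
    let q : ι → L := fun k => v k - T.starProjection (v k)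
    have hp : ∀ k, p k ∈ T := fun k => T.starProjection_apply_mem _
    have hq : ∀ k, q k ∈ Tᗮ := fun k => T.sub_starProjection_mem_orthogonal _
    have hpq : ∀ k, v k = p k + q k := fun k => by simp [p, q]
    have h1 := ih _ (Submodule.finrank_lt_finrank_of_lt hlt) T hT p hp rfl
    have h2 := ih _ (Submodule.finrank_lt_finrank_of_lt hlt') (Tᗮ ⊓ S)
      (fun a w hw => ⟨hTo a w hw.1, hS a w hw.2⟩) q
      (fun k => ⟨hq k, S.sub_mem (hv k) (hTS (hp k))⟩) rfl
    have pyth : ∀ x ∈ T, ∀ y ∈ Tᗮ, ‖x + y‖ ^ 2 = ‖x‖ ^ 2 + ‖y‖ ^ 2 := fun x hx y hy => by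
      simpa [sq] using norm_add_sq_eq_norm_sq_add_norm_sq_of_inner_eq_zero x y (hy x hx)
    have hL : ‖∑ j, ρ (z j) (v j)‖ ^ 2 =
        ‖∑ j, ρ (z j) (p j)‖ ^ 2 + ‖∑ j, ρ (z j) (q j)‖ ^ 2 := by
      rw [← pyth _ (T.sum_mem fun j _ => hT _ _ (hp j)) _ (Tᗮ.sum_mem fun j _ => hTo _ _ (hq j)),
        ← Finset.sum_add_distrib]
      simp_rw [← map_add, ← hpq]
    have hR : ∀ j k, ‖ρ (z j) (v k)‖ ^ 2 = ‖ρ (z j) (p k)‖ ^ 2 + ‖ρ (z j) (q k)‖ ^ 2 := by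
      intro j k
      rw [← pyth _ (hT _ _ (hp k)) _ (hTo _ _ (hq k)), ← map_add, ← hpq]
    simp_rw [hL, hR, Finset.sum_add_distrib, mul_add]
    exact add_le_add h1 h2

/-- In a finite-dimensional representation of an `n`-subhomogeneous C*-algebra, the norm of the
trace of a matrix with entries `ρ (z j) (v k)` is at most `√n` times its Hilbert-Schmidt norm. -/
lemma IsSubhomogeneous.norm_sq_sum_apply_le [CompleteSpace L] {n : ℕ} (hF : IsSubhomogeneous n F)
    (ρ : F →⋆ₙₐ[ℂ] (L →L[ℂ] L)) {ι : Type*} [Fintype ι] (z : ι → F) (v : ι → L) :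
    ‖∑ j, ρ (z j) (v j)‖ ^ 2 ≤ n * ∑ j, ∑ k, ‖ρ (z j) (v k)‖ ^ 2 :=
  hF.norm_sq_sum_apply_le_of_mem ρ z ⊤ (fun _ _ _ => Submodule.mem_top) v
    fun _ => Submodule.mem_top

end FiniteDimensional

section Dilation

variable {A H : Type} [NonUnitalCStarAlgebra A] [NormedAddCommGroup H] [InnerProductSpace ℂ H]
  [CompleteSpace H]

/-- The positive functional `y ↦ ∑ i j, ⟪v i, π (y i j) (v j)⟫` is nonnegative on positive
matrices. -/
lemma IsPosElem.sum_inner_nonneg {m : ℕ} {x : Matrix (Fin m) (Fin m) A} (hx : IsPosElem x)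
    (π : A →⋆ₙₐ[ℂ] (H →L[ℂ] H)) (v : Fin m → H) :
    ∃ r : ℝ, 0 ≤ r ∧ ∑ i, ∑ j, inner ℂ (v i) (π (x i j) (v j)) = (r : ℂ) := by
  obtain ⟨b, hb⟩ := hx
  have hb' : ∀ i j, x i j = ∑ l, star (b l i) * b l j := by
    intro i j
    rw [hb, Matrix.star_eq_conjTranspose]
    simp [Matrix.mul_apply]
  refine ⟨∑ l, ‖∑ j, π (b l j) (v j)‖ ^ 2, by positivity, ?_⟩
  have hinner : ∀ i j, inner ℂ (v i) (π (x i j) (v j)) =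
      ∑ l, inner ℂ (π (b l i) (v i)) (π (b l j) (v j)) := by
    intro i j
    simp only [hb', map_sum, map_mul, map_star, sum_apply,
      mul_apply_eq_comp, inner_sum, ContinuousLinearMap.star_eq_adjoint,
      ContinuousLinearMap.adjoint_inner_right]
  simp_rw [hinner]
  rw [Finset.sum_congr rfl fun i _ => Finset.sum_comm, Finset.sum_comm, Complex.ofReal_sum]
  refine Finset.sum_congr rfl fun l _ => ?_
  rw [Complex.ofReal_pow, ← Complex.coe_algebraMap, ← inner_self_eq_norm_sq_to_K (𝕜 := ℂ)]
  simp_rw [sum_inner, inner_sum]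

lemma IsPosElem.of_nonneg {B : Type*} [NonUnitalCStarAlgebra B] [PartialOrder B] [StarOrderedRing B]
    {x : B} (hx : 0 ≤ x) : IsPosElem x :=
  CStarAlgebra.nonneg_iff_eq_star_mul_self.1 hx

/-- The diagonal embedding of a C*-algebra into matrices over it. -/
def diagonalHom (m : ℕ) (F : Type*) [CStarAlgebra F] :
    F →⋆ₙₐ[ℂ] CStarMatrix (Fin m) (Fin m) F where
  toFun y := CStarMatrix.ofMatrix (Matrix.diagonal fun _ => y)
  map_smul' c y := by
    ext i j
    by_cases h : i = j <;> simp [h]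
  map_zero' := by
    ext i j
    simp
  map_add' x y := by
    ext i j
    by_cases h : i = j <;> simp [h]
  map_mul' x y := congrArg CStarMatrix.ofMatrix (Matrix.diagonal_mul_diagonal _ _).symm
  map_star' x := congrArg CStarMatrix.ofMatrix (Matrix.diagonal_conjTranspose _).symm

open scoped ComplexOrder in
/-- A **Stinespring dilation**, cut down to finitely many vectors, of a completely positive map on a
finite-dimensional C*-algebra composed with a representation. -/
lemma CompletelyPositive.exists_dilation {F : Type} [CStarAlgebra F] [FiniteDimensional ℂ F]
    {ψ : F →ₗ[ℂ] A} (hψ : CompletelyPositive ψ) (π : A →⋆ₙₐ[ℂ] (H →L[ℂ] H))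
    {m : ℕ} [NeZero m] (v : Fin m → H) :
    ∃ (L : Type) (_ : NormedAddCommGroup L) (_ : InnerProductSpace ℂ L)
      (_ : FiniteDimensional ℂ L) (_ : CompleteSpace L) (ρ : F →⋆ₙₐ[ℂ] (L →L[ℂ] L))
      (u : Fin m → L), ∀ y w i j,
      inner ℂ (ρ w (u i)) (ρ y (u j)) = inner ℂ (v i) (π (ψ (star w * y)) (v j)) := by
  let _ : PartialOrder F := CStarAlgebra.spectralOrder F
  have _ : StarOrderedRing F := CStarAlgebra.spectralOrderedRing F
  let f₀ : CStarMatrix (Fin m) (Fin m) F →ₗ[ℂ] ℂ :=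
    { toFun := fun Y => ∑ i, ∑ j, inner ℂ (v i) (π (ψ (Y i j)) (v j))
      map_add' := fun X Y => by simp [Finset.sum_add_distrib]
      map_smul' := fun c Y => by simp [Finset.mul_sum] }
  let f : CStarMatrix (Fin m) (Fin m) F →ₚ[ℂ] ℂ := PositiveLinearMap.mk₀ f₀ fun Y hY => by
    obtain ⟨b, hb⟩ := IsPosElem.of_nonneg hY
    obtain ⟨r, hr, h⟩ := (hψ m (CStarMatrix.ofMatrix.symm Y) ⟨b, hb⟩).sum_inner_nonneg π v
    have : f₀ Y = r := h
    rw [this]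
    exact_mod_cast hr
  have hf : ∀ Y, f Y = ∑ i, ∑ j, inner ℂ (v i) (π (ψ (Y i j)) (v j)) := fun Y => rfl
  have hfin : FiniteDimensional ℂ f.GNS := by
    have : FiniteDimensional ℂ (CStarMatrix (Fin m) (Fin m) F) :=
      inferInstanceAs (FiniteDimensional ℂ (Matrix (Fin m) (Fin m) F))
    have h1 : FiniteDimensional ℂ f.PreGNS := f.toPreGNS.finiteDimensional
    let c : f.PreGNS →ₗ[ℂ] f.GNS := (UniformSpace.Completion.toComplL (𝕜 := ℂ)).toLinearMap
    have h2 : LinearMap.range c = ⊤ := by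
      have h3 : IsClosed (LinearMap.range c : Set f.GNS) := Submodule.closed_of_finiteDimensional _
      rw [← SetLike.coe_set_eq, ← h3.closure_eq, Submodule.top_coe]
      exact UniformSpace.Completion.denseRange_coe.closure_range
    exact Module.Finite.of_surjective c (LinearMap.range_eq_top.1 h2)
  let u : Fin m → f.PreGNS := fun j =>
    f.toPreGNS (CStarMatrix.ofMatrix (Matrix.single 0 j 1))
  refine ⟨f.GNS, inferInstance, inferInstance, hfin, inferInstance,
    f.gnsNonUnitalStarAlgHom.comp (diagonalHom m F), fun j => (u j : f.GNS), ?_⟩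
  intro y w i j
  have hu : ∀ y j, f.ofPreGNS (f.leftMulMapPreGNS (diagonalHom m F y) (u j)) =
      CStarMatrix.ofMatrix (Matrix.single 0 j y) := by
    intro y j
    change CStarMatrix.ofMatrix (Matrix.diagonal (fun _ => y) * Matrix.single 0 j 1) = _
    congr 1
    ext k l
    simp [Matrix.diagonal_mul, Matrix.single_apply]
  simp only [NonUnitalStarAlgHom.comp_apply, PositiveLinearMap.gnsNonUnitalStarAlgHom_apply_coe,
    UniformSpace.Completion.inner_coe, PositiveLinearMap.preGNS_inner_def, hu]
  have h1 : star (CStarMatrix.ofMatrix (Matrix.single (0 : Fin m) i w)) *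
      CStarMatrix.ofMatrix (Matrix.single 0 j y) =
      CStarMatrix.ofMatrix (Matrix.single i j (star w * y)) := by
    change CStarMatrix.ofMatrix ((Matrix.single (0 : Fin m) i w).conjTranspose *
      Matrix.single 0 j y) = _
    simp
  rw [h1, hf, Finset.sum_eq_single i, Finset.sum_eq_single j]
  · simp
  · intro k _ hk
    simp [hk.symm]
  · simp
  · intro k _ hk
    simp [hk.symm]
  · simp

end Dilation

section Main

variable {A H : Type} [NonUnitalCStarAlgebra A] [NormedAddCommGroup H] [InnerProductSpace ℂ H]
  [CompleteSpace H]

/-- If the identity factors approximately through the finite-dimensional `n`-subhomogeneous algebra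
`F`, the trace inequality for `F` passes to `A`. -/
lemma norm_sum_inner_le_of_completelyPositive {n : ℕ} {F : Type} [CStarAlgebra F]
    [FiniteDimensional ℂ F] (hF : IsSubhomogeneous n F) {φ : A →ₗ[ℂ] F} {ψ : F →ₗ[ℂ] A}
    (hφ : CompletelyPositive φ) (hψ : CompletelyPositive ψ) (π : A →⋆ₙₐ[ℂ] (H →L[ℂ] H))
    {m : ℕ} [NeZero m] (c : Fin m → A) (v : Fin m → H) :
    (∑ i, ∑ j, inner ℂ (v i) (π (ψ (φ (star (c i) * c j))) (v j))).re ≤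
      n * ∑ i, ∑ k, (inner ℂ (v k) (π (ψ (φ (star (c i) * c i))) (v k))).re := by
  obtain ⟨L, _, _, _, _, ρ, u, hu⟩ := hψ.exists_dilation π v
  obtain ⟨b, hb⟩ := hφ m (Matrix.of fun i j => star (c i) * c j)
    ⟨Matrix.of fun l j => if l = 0 then c j else 0, by
      ext i j
      simp [Matrix.mul_apply]⟩
  have hb' : ∀ i j, φ (star (c i) * c j) = ∑ l, star (b l i) * b l j := by
    intro i j
    have := congrFun (congrFun hb i) j
    simpa [Matrix.mul_apply] using this
  have hinner : ∀ i i' j j', inner ℂ (v i) (π (ψ (φ (star (c i') * c j'))) (v j)) =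
      ∑ l, inner ℂ (ρ (b l i') (u i)) (ρ (b l j') (u j)) := by
    intro i i' j j'
    simp only [hb', map_sum, sum_apply, inner_sum, hu]
  have hleft : (∑ i, ∑ j, inner ℂ (v i) (π (ψ (φ (star (c i) * c j))) (v j))).re =
      ∑ l, ‖∑ j, ρ (b l j) (u j)‖ ^ 2 := by
    simp_rw [hinner]
    rw [Finset.sum_congr rfl fun i _ => Finset.sum_comm, Finset.sum_comm, Complex.re_sum]
    refine Finset.sum_congr rfl fun l _ => ?_
    rw [← inner_self_eq_norm_sq (𝕜 := ℂ), sum_inner]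
    simp_rw [inner_sum]
    rfl
  have hright : ∑ i, ∑ k, (inner ℂ (v k) (π (ψ (φ (star (c i) * c i))) (v k))).re =
      ∑ l, ∑ i, ∑ k, ‖ρ (b l i) (u k)‖ ^ 2 := by
    simp_rw [hinner, Complex.re_sum]
    rw [Finset.sum_congr rfl fun i _ => Finset.sum_comm, Finset.sum_comm]
    simp_rw [← inner_self_eq_norm_sq (𝕜 := ℂ)]
    rfl
  rw [hleft, hright, Finset.mul_sum]
  exact Finset.sum_le_sum fun l _ => hF.norm_sq_sum_apply_le ρ (b l) u

/-- The trace inequality in an arbitrary representation of an algebra with an approximating net. -/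
lemma CcpApproxNet.norm_sq_sum_apply_le {n : ℕ} (N : CcpApproxNet n A)
    (π : A →⋆ₙₐ[ℂ] (H →L[ℂ] H)) {m : ℕ} [NeZero m] (c : Fin m → A) (v : Fin m → H) :
    ‖∑ j, π (c j) (v j)‖ ^ 2 ≤ n * ∑ i, ∑ k, ‖π (c i) (v k)‖ ^ 2 := by
  let _ := N.pre
  let _ := N.ne
  let _ := N.instF
  have := N.findim
  have : IsDirectedOrder N.ι := ⟨N.directed⟩
  have hπ : Continuous π :=
    AddMonoidHomClass.continuous_of_bound π 1 fun a => by
      simpa using NonUnitalStarAlgHom.norm_apply_le π a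
  have hlim : ∀ (x : A) (w w' : H), Tendsto
      (fun i => inner ℂ w (π (N.ψ i (N.φ i x)) w')) atTop (𝓝 (inner ℂ w (π x w'))) := by
    intro x w w'
    have h1 : Tendsto (fun i => N.ψ i (N.φ i x)) atTop (𝓝 x) := by
      rw [tendsto_iff_norm_sub_tendsto_zero]
      simpa only [norm_sub_rev] using N.approx x
    have h2 : Continuous fun a => inner ℂ w (π a w') := by fun_prop
    exact (h2.tendsto x).comp h1
  have hl := (Complex.continuous_re.tendsto _).comp (tendsto_finsetSum Finset.univ fun i _ =>
    tendsto_finsetSum Finset.univ fun j _ => hlim (star (c i) * c j) (v i) (v j))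
  have hr := (tendsto_finsetSum Finset.univ fun i _ =>
    tendsto_finsetSum Finset.univ fun k _ => (Complex.continuous_re.tendsto _).comp
      (hlim (star (c i) * c i) (v k) (v k))).const_mul (n : ℝ)
  have key := le_of_tendsto_of_tendsto' hl hr fun i =>
    norm_sum_inner_le_of_completelyPositive (N.subhom i) (N.φ_cp i) (N.ψ_cp i) π c v
  have hin : ∀ a b x y, inner ℂ x (π (star a * b) y) = inner ℂ (π a x) (π b y) := by
    intro a b x y
    simp [map_star, ContinuousLinearMap.star_eq_adjoint, ContinuousLinearMap.adjoint_inner_right]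
  simp_rw [hin] at key
  simp_rw [← inner_self_eq_norm_sq (𝕜 := ℂ), sum_inner, inner_sum]
  exact key

end Main

/-- If a C*-algebra `A` admits a net of contractive completely positive
maps through finite-dimensional `n`-subhomogeneous C*-algebras approximating the identity
in point-norm, then `A` is `n`-subhomogeneous. -/
theorem stmt14 (n : ℕ) (hn : 1 ≤ n) (A : Type) [NonUnitalCStarAlgebra A]
    (h : Nonempty (CcpApproxNet n A)) : IsSubhomogeneous n A := by
  intro H _ _ _ π hπ
  obtain ⟨N⟩ := h
  by_contra! hlt
  obtain ⟨v, hv⟩ := exists_linearIndependent_of_le_rank (R := ℂ) (M := H) (n := n + 1) (by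
    rw [Nat.cast_add_one, ← Cardinal.succ_natCast]
    exact Order.succ_le_of_lt hlt)
  let C : Set (Fin (n + 1) → Fin (n + 1) → H) :=
    {T | ‖∑ j, T j j‖ ^ 2 ≤ n * ∑ j, ∑ k, ‖T j k‖ ^ 2}
  have hC : IsClosed C := isClosed_le (by fun_prop) (by fun_prop)
  have hdense : DenseRange fun (c : Fin (n + 1) → A) j k => π (c j) (v k) :=
    DenseRange.piMap fun _ => hπ.dense_range_apply hv
  have hCtop : ∀ T, T ∈ C := fun T =>
    hC.closure_subset_iff.2 (Set.range_subset_iff.2 fun c => N.norm_sq_sum_apply_le π c v)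
      (hdense T)
  have h0 := hCtop fun j k => if j = k then v 0 else 0
  have hv0 : 0 < ‖v 0‖ ^ 2 := by
    have := norm_pos_iff.2 (hv.ne_zero 0)
    positivity
  simp only [C, Set.mem_ofPred_eq, if_true, Finset.sum_const, Finset.card_univ, Fintype.card_fin,
    apply_ite norm, norm_zero, ite_pow, ne_eq, OfNat.ofNat_ne_zero, not_false_eq_true, zero_pow,
    Finset.sum_ite_eq, Finset.mem_univ, nsmul_eq_mul] at h0
  rw [← Nat.cast_smul_eq_nsmul ℝ, norm_smul, mul_pow] at h0
  simp only [Real.norm_natCast] at h0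
  push_cast at h0
  nlinarith [mul_pos (Nat.cast_add_one_pos (α := ℝ) n) hv0]

end
end
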